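/- arXiv:2210.01074 — 3 statements merged into one kernel-verified Lean document; each statement's English description precedes it below -/
import Mathlib

section
/- Let f : [a,b] → ℝ admit an analytic extension, i.e. there exists an open interval (α,β) ⊃ [a,b] and a real-analytic function F : (α,β) → ℝ with F(x) = f(x) for all x ∈ [a,b]. Then there exist constants C, γ > 0, depending only on f, such that for every L ∈ ℕ there exists a ReLU neural network Φ_L : ℝ → ℝ with sup_{x∈[a,b]} |f(x) − Φ_L(x)| ≤ C·exp(−γ·L^{1/2}), depth(Φ_L) ≤ C·L and width(Φ_L) ≤ C. -/
open scoped BigOperators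

/-- A ReLU neural network with input dimension `din` and output dimension `dout`:
a composition of `depth + 1` affine maps, with the componentwise ReLU activation
applied after each of the first `depth` affine maps (i.e. `depth` hidden layers). -/
structure ReLUNet (din dout : ℕ) where
  depth : ℕ
  dims : ℕ → ℕ
  dims_in : dims 0 = din
  dims_out : dims (depth + 1) = dout
  W : (ℓ : ℕ) → Matrix (Fin (dims (ℓ + 1))) (Fin (dims ℓ)) ℝ
  b : (ℓ : ℕ) → Fin (dims (ℓ + 1)) → ℝ

namespace ReLUNet

variable {din dout : ℕ}

/-- The activations after `ℓ` hidden layers. -/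
noncomputable def hidden (Φ : ReLUNet din dout) : (ℓ : ℕ) → (Fin din → ℝ) → Fin (Φ.dims ℓ) → ℝ
  | 0, x, i => x (finCongr Φ.dims_in i)
  | ℓ + 1, x, i => max ((Φ.W ℓ).mulVec (Φ.hidden ℓ x) i + Φ.b ℓ i) 0

/-- Evaluation of a ReLU network: final affine layer applied to the last hidden activations. -/
noncomputable def eval (Φ : ReLUNet din dout) (x : Fin din → ℝ) : Fin dout → ℝ := fun i =>
  (Φ.W Φ.depth).mulVec (Φ.hidden Φ.depth x) (finCongr Φ.dims_out.symm i) +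
    Φ.b Φ.depth (finCongr Φ.dims_out.symm i)

/-- The width: maximal dimension of a hidden layer. -/
def width (Φ : ReLUNet din dout) : ℕ := (Finset.Icc 1 Φ.depth).sup Φ.dims

/-- The size: total number of entries of all weight matrices and bias vectors. -/
def size (Φ : ReLUNet din dout) : ℕ :=
  ∑ ℓ ∈ Finset.range (Φ.depth + 1), (Φ.dims (ℓ + 1) * Φ.dims ℓ + Φ.dims (ℓ + 1))

/-- Scalar evaluation for networks with one-dimensional output. -/
noncomputable def evalS (Φ : ReLUNet din 1) (x : Fin din → ℝ) : ℝ := Φ.eval x 0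

/-- Scalar evaluation for scalar-to-scalar networks. -/
noncomputable def eval1 (Φ : ReLUNet 1 1) (x : ℝ) : ℝ := Φ.eval (fun _ => x) 0

/-- Scalar evaluation for two-input networks. -/
noncomputable def eval2 (Φ : ReLUNet 2 1) (x y : ℝ) : ℝ := Φ.eval ![x, y] 0

end ReLUNet

namespace ReLUNet

section LayerCalculus

variable {X Y : Type*}

/-- The ReLU activation applied pointwise to a real-valued function. -/
def relu (g : X → ℝ) : X → ℝ := fun x => max (g x) 0

/-- The span of a set of real-valued functions together with the constant functions. -/
def spanOne (S : Set (X → ℝ)) : Submodule ℝ (X → ℝ) := Submodule.span ℝ (insert 1 S)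

/-- Every function in `V'` is an affine combination of at most `k` neurons whose preactivations
lie in `V`. -/
def LayerStep (k : ℕ) (V V' : Submodule ℝ (X → ℝ)) : Prop :=
  ∃ s : Finset (X → ℝ), s.card ≤ k ∧ (∀ g ∈ s, g ∈ V) ∧ V' ≤ spanOne (relu '' (s : Set (X → ℝ)))

/-- `V'` is reached from `V` by `n` successive layers of width at most `k`. -/
def LayerSteps (k : ℕ) : ℕ → Submodule ℝ (X → ℝ) → Submodule ℝ (X → ℝ) → Prop
  | 0, V, V' => V' ≤ V
  | n + 1, V, V' => ∃ U, LayerSteps k n V U ∧ LayerStep k U V'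

lemma one_mem_spanOne (S : Set (X → ℝ)) : (1 : X → ℝ) ∈ spanOne S :=
  Submodule.subset_span (Set.mem_insert _ _)

lemma mem_spanOne {S : Set (X → ℝ)} {g : X → ℝ} (h : g ∈ S) : g ∈ spanOne S :=
  Submodule.subset_span (Set.mem_insert_of_mem _ h)

lemma spanOne_le {S : Set (X → ℝ)} {V : Submodule ℝ (X → ℝ)} (h1 : (1 : X → ℝ) ∈ V)
    (h : ∀ g ∈ S, g ∈ V) : spanOne S ≤ V :=
  Submodule.span_le.2 (Set.insert_subset h1 h)

lemma spanOne_mono {S T : Set (X → ℝ)} (h : S ⊆ T) : spanOne S ≤ spanOne T :=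
  Submodule.span_mono (Set.insert_subset_insert h)

lemma relu_mem_spanOne {s : Finset (X → ℝ)} {g : X → ℝ} (hg : g ∈ s) :
    relu g ∈ spanOne (relu '' (s : Set (X → ℝ))) :=
  mem_spanOne (Set.mem_image_of_mem _ hg)

lemma relu_sub_relu_neg (g : X → ℝ) : relu g - relu (-g) = g := by
  ext x
  simp only [relu, Pi.sub_apply, Pi.neg_apply]
  rcases le_total (g x) 0 with h | h
  · rw [max_eq_right h, max_eq_left (by linarith)]; ring
  · rw [max_eq_left h, max_eq_right (by linarith)]; ring

lemma LayerStep.mono {k l : ℕ} {V V' U U' : Submodule ℝ (X → ℝ)} (h : LayerStep k V V')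
    (hk : k ≤ l) (hV : V ≤ U) (hV' : U' ≤ V') : LayerStep l U U' := by
  obtain ⟨s, hs, hs1, hs2⟩ := h
  exact ⟨s, hs.trans hk, fun g hg => hV (hs1 g hg), hV'.trans hs2⟩

lemma LayerStep.sup {k l : ℕ} {V V' U U' : Submodule ℝ (X → ℝ)} (h : LayerStep k V V')
    (h' : LayerStep l U U') : LayerStep (k + l) (V ⊔ U) (V' ⊔ U') := by
  classical
  obtain ⟨s, hs, hs1, hs2⟩ := h
  obtain ⟨t, ht, ht1, ht2⟩ := h'
  refine ⟨s ∪ t, (Finset.card_union_le _ _).trans (add_le_add hs ht), ?_, ?_⟩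
  · intro g hg
    rcases Finset.mem_union.1 hg with hg | hg
    · exact le_sup_left (a := V) (hs1 g hg)
    · exact le_sup_right (a := V) (ht1 g hg)
  · exact sup_le
      (hs2.trans (spanOne_mono (Set.image_mono (Finset.coe_subset.2 Finset.subset_union_left))))
      (ht2.trans (spanOne_mono (Set.image_mono (Finset.coe_subset.2 Finset.subset_union_right))))

lemma LayerStep.comp {k : ℕ} {V V' : Submodule ℝ (X → ℝ)} (h : LayerStep k V V') (φ : Y → X) :
    LayerStep k (V.map (LinearMap.funLeft ℝ ℝ φ)) (V'.map (LinearMap.funLeft ℝ ℝ φ)) := by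
  classical
  obtain ⟨s, hs, hs1, hs2⟩ := h
  refine ⟨s.image (LinearMap.funLeft ℝ ℝ φ), Finset.card_image_le.trans hs, ?_, ?_⟩
  · intro g hg
    obtain ⟨u, hu, rfl⟩ := Finset.mem_image.1 hg
    exact Submodule.mem_map_of_mem (hs1 u hu)
  · refine (Submodule.map_mono hs2).trans ?_
    rw [spanOne, Submodule.map_span, Submodule.span_le]
    rintro _ ⟨g, hg | ⟨u, hu, rfl⟩, rfl⟩
    · rw [hg]; exact one_mem_spanOne _
    · exact relu_mem_spanOne (g := LinearMap.funLeft ℝ ℝ φ u) (Finset.mem_image_of_mem _ hu)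

lemma LayerStep.refl (u : X → ℝ) : LayerStep 2 (spanOne {u}) (spanOne {u}) := by
  classical
  refine ⟨{u, -u}, Finset.card_le_two, ?_, spanOne_le (one_mem_spanOne _) ?_⟩
  · have h : u ∈ spanOne {u} := mem_spanOne rfl
    intro g hg
    rcases Finset.mem_insert.1 hg with rfl | hg
    · exact h
    · rw [Finset.mem_singleton.1 hg]; exact neg_mem h
  · rintro g rfl
    have h := sub_mem (relu_mem_spanOne (s := {g, -g}) (g := g) (by simp))
      (relu_mem_spanOne (s := {g, -g}) (g := -g) (by simp))
    rwa [relu_sub_relu_neg] at h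

lemma LayerSteps.mono {k l n : ℕ} {V V' U U' : Submodule ℝ (X → ℝ)} (h : LayerSteps k n V V')
    (hk : k ≤ l) (hV : V ≤ U) (hV' : U' ≤ V') : LayerSteps l n U U' := by
  induction n generalizing V' U' with
  | zero => exact (hV'.trans h).trans hV
  | succ n ih =>
    obtain ⟨W, hW, hs⟩ := h
    exact ⟨W, ih hW le_rfl, hs.mono hk le_rfl hV'⟩

lemma LayerSteps.trans {k m n : ℕ} {V U W : Submodule ℝ (X → ℝ)} (h : LayerSteps k m V U)
    (h' : LayerSteps k n U W) : LayerSteps k (m + n) V W := by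
  induction n generalizing W with
  | zero => exact h.mono le_rfl le_rfl h'
  | succ n ih =>
    obtain ⟨W', hW, hs⟩ := h'
    exact ⟨W', ih hW, hs⟩

lemma LayerSteps.sup {k l n : ℕ} {V V' U U' : Submodule ℝ (X → ℝ)} (h : LayerSteps k n V V')
    (h' : LayerSteps l n U U') : LayerSteps (k + l) n (V ⊔ U) (V' ⊔ U') := by
  induction n generalizing V' U' with
  | zero => exact sup_le_sup h h'
  | succ n ih =>
    obtain ⟨W, hW, hs⟩ := h
    obtain ⟨W', hW', hs'⟩ := h'
    exact ⟨W ⊔ W', ih hW hW', hs.sup hs'⟩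

lemma LayerSteps.comp {k n : ℕ} {V V' : Submodule ℝ (X → ℝ)} (h : LayerSteps k n V V')
    (φ : Y → X) :
    LayerSteps k n (V.map (LinearMap.funLeft ℝ ℝ φ)) (V'.map (LinearMap.funLeft ℝ ℝ φ)) := by
  induction n generalizing V' with
  | zero => exact Submodule.map_mono h
  | succ n ih =>
    obtain ⟨W, hW, hs⟩ := h
    exact ⟨_, ih hW, hs.comp φ⟩

lemma map_funLeft_spanOne (S : Set (X → ℝ)) (φ : Y → X) :
    (spanOne S).map (LinearMap.funLeft ℝ ℝ φ) = spanOne ((fun g => g ∘ φ) '' S) := by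
  rw [spanOne, Submodule.map_span, Set.image_insert_eq]
  rfl

lemma LayerSteps.refl (u : X → ℝ) (n : ℕ) : LayerSteps 2 n (spanOne {u}) (spanOne {u}) := by
  induction n with
  | zero => exact le_rfl
  | succ n ih => exact ⟨_, ih, LayerStep.refl u⟩

lemma LayerSteps.pad {k m n : ℕ} {V : Submodule ℝ (X → ℝ)} {g : X → ℝ}
    (h : LayerSteps k m V (spanOne {g})) (hmn : m ≤ n) :
    LayerSteps (k + 2) n V (spanOne {g}) := by
  obtain ⟨d, rfl⟩ := Nat.exists_eq_add_of_le hmn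
  exact (h.mono (by omega) le_rfl le_rfl).trans
    ((LayerSteps.refl g d).mono (by omega) le_rfl le_rfl)

lemma LayerSteps.exists_chain {k n : ℕ} {V V' : Submodule ℝ (X → ℝ)} (h : LayerSteps k n V V') :
    ∃ U : ℕ → Submodule ℝ (X → ℝ), U 0 = V ∧ V' ≤ U n ∧
      ∀ i, LayerStep k (U i) (U (i + 1)) := by
  have hbot : ∀ W : Submodule ℝ (X → ℝ), LayerStep k W ⊥ := fun W =>
    ⟨∅, by simp, by simp, bot_le⟩
  induction n generalizing V' with
  | zero =>
    refine ⟨fun i => if i = 0 then V else ⊥, by simp, h, fun i => ?_⟩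
    simpa using hbot _
  | succ n ih =>
    obtain ⟨W, hW, hs⟩ := h
    obtain ⟨U, hU0, hUn, hU⟩ := ih hW
    refine ⟨fun i => if i ≤ n then U i else if i = n + 1 then V' else ⊥, by simpa using hU0,
      by simp, fun i => ?_⟩
    rcases lt_trichotomy i n with hi | rfl | hi
    · simpa [show i ≤ n by omega, show i + 1 ≤ n by omega] using hU i
    · simpa using hs.mono le_rfl hUn le_rfl
    · simpa [show ¬ i + 1 ≤ n by omega, show i ≠ n by omega] using hbot _

lemma exists_coeff_of_mem_spanOne {h : ℕ → X → ℝ} {d : ℕ} {g : X → ℝ}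
    (hg : g ∈ spanOne (h '' (Finset.range d : Set ℕ))) :
    ∃ (c : ℕ → ℝ) (c₀ : ℝ), ∀ x, g x = ∑ j ∈ Finset.range d, c j * h j x + c₀ := by
  obtain ⟨c₀, z, hz, rfl⟩ := Submodule.mem_span_insert.1 hg
  obtain ⟨c, rfl⟩ := (Submodule.mem_span_image_finset_iff_exists_fun ℝ).1 hz
  refine ⟨fun j => if hj : j ∈ Finset.range d then c ⟨j, hj⟩ else 0, c₀, fun x => ?_⟩
  rw [← Finset.sum_coe_sort (Finset.range d)]
  simp only [Pi.add_apply, Pi.smul_apply, Finset.sum_apply, smul_eq_mul, Pi.one_apply, mul_one]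
  rw [add_comm]
  congr 1
  refine Finset.sum_congr rfl fun j _ => ?_
  rw [dif_pos j.2]

lemma LayerStep.exists_neurons {k : ℕ} {V V' : Submodule ℝ (X → ℝ)} (h : LayerStep k V V') :
    ∃ g : ℕ → X → ℝ, (∀ i, g i ∈ V) ∧
      V' ≤ spanOne ((fun i => relu (g i)) '' (Finset.range k : Set ℕ)) := by
  obtain ⟨s, hs, hs1, hs2⟩ := h
  refine ⟨fun i => if hi : i < s.card then (s.equivFin.symm ⟨i, hi⟩ : X → ℝ) else 0, ?_,
    hs2.trans (spanOne_mono ?_)⟩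
  · intro i
    dsimp only
    split_ifs with hi
    · exact hs1 _ (s.equivFin.symm ⟨i, hi⟩).2
    · exact zero_mem _
  · rintro _ ⟨u, hu, rfl⟩
    refine ⟨s.equivFin ⟨u, hu⟩, ?_, ?_⟩
    · simpa using (s.equivFin ⟨u, hu⟩).2.trans_le hs
    · simp

end LayerCalculus

/-- Functions reachable from affine functions by `n` layers of width `k` are realized by networks
of depth `n` and width at most `k`. -/
lemma exists_net_of_layerSteps {k n : ℕ} {g : ℝ → ℝ}
    (h : LayerSteps k n (spanOne {id}) (spanOne {g})) :
    ∃ Φ : ReLUNet 1 1, Φ.depth = n ∧ Φ.width ≤ k ∧ ∀ x, Φ.eval1 x = g x := by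
  obtain ⟨U, hU0, hUn, hU⟩ := h.exists_chain
  choose s hs hs' using fun i => (hU i).exists_neurons
  let d : ℕ → ℕ := fun ℓ => if ℓ = 0 then 1 else if ℓ = n + 1 then 1 else k
  let H : ℕ → ℕ → ℝ → ℝ := fun ℓ i => match ℓ with
    | 0 => id
    | ℓ + 1 => relu (s ℓ i)
  have hUH : ∀ ℓ ≤ n, U ℓ ≤ spanOne (H ℓ '' (Finset.range (d ℓ) : Set ℕ)) := by
    intro ℓ hℓ
    cases ℓ with
    | zero =>
      rw [hU0]
      refine spanOne_mono ?_
      rintro _ rfl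
      exact ⟨0, by simp [d], rfl⟩
    | succ ℓ =>
      have : d (ℓ + 1) = k := by simp [d]; omega
      rw [this]
      exact hs' ℓ
  have hcoef : ∀ ℓ i, ∃ (c : ℕ → ℝ) (c₀ : ℝ), ℓ ≤ n → ∀ x, (if ℓ = n then g else s ℓ i) x =
      ∑ j ∈ Finset.range (d ℓ), c j * H ℓ j x + c₀ := by
    intro ℓ i
    by_cases hℓ : ℓ ≤ n
    · have hmem : (if ℓ = n then g else s ℓ i) ∈ U ℓ := by
        split_ifs with h
        · rw [h]; exact hUn (mem_spanOne rfl)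
        · exact hs ℓ i
      obtain ⟨c, c₀, hc⟩ := exists_coeff_of_mem_spanOne (hUH ℓ hℓ hmem)
      exact ⟨c, c₀, fun _ => hc⟩
    · exact ⟨0, 0, fun h' => absurd h' hℓ⟩
  choose w b hwb using hcoef
  let Φ : ReLUNet 1 1 :=
    { depth := n
      dims := d
      dims_in := by simp [d]
      dims_out := by simp [d]
      W := fun ℓ => Matrix.of fun i j => w ℓ i j
      b := fun ℓ i => b ℓ i }
  have hsum : ∀ ℓ ≤ n, ∀ x : ℝ, (∀ j, Φ.hidden ℓ (fun _ => x) j = H ℓ j x) →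
      ∀ i : Fin (d (ℓ + 1)), (Φ.W ℓ).mulVec (Φ.hidden ℓ (fun _ => x)) i + Φ.b ℓ i =
        (if ℓ = n then g else s ℓ i) x := by
    intro ℓ hℓ x hj i
    rw [hwb ℓ i hℓ x, ← Fin.sum_univ_eq_sum_range (fun j => w ℓ i j * H ℓ j x)]
    simp only [Matrix.mulVec, dotProduct, hj]
    rfl
  have hhid : ∀ ℓ ≤ n, ∀ x : ℝ, ∀ j, Φ.hidden ℓ (fun _ => x) j = H ℓ j x := by
    intro ℓ
    induction ℓ with
    | zero => intro _ x j; rfl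
    | succ ℓ ih =>
      intro hℓ x j
      rw [hidden, hsum ℓ (by omega) x (ih (by omega) x) j, if_neg (by omega)]
      rfl
  refine ⟨Φ, rfl, ?_, fun x => ?_⟩
  · refine Finset.sup_le fun ℓ hℓ => ?_
    have : 1 ≤ ℓ ∧ ℓ ≤ n := Finset.mem_Icc.1 hℓ
    simp [Φ, d, show ℓ ≠ 0 by omega, show ℓ ≠ n + 1 by omega]
  · have := hsum n le_rfl x (hhid n le_rfl x) (finCongr Φ.dims_out.symm 0)
    rw [if_pos rfl] at this
    exact this

/-- The tent map, written with two ReLU neurons. -/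
noncomputable def tent (t : ℝ) : ℝ := 2 * max t 0 - 4 * max (t - 1 / 2) 0

/-- The partial sums of the sawtooth expansion `t - t ^ 2 = ∑ s, tent^[s + 1] t / 4 ^ (s + 1)`. -/
noncomputable def tentSum (r : ℕ) (t : ℝ) : ℝ :=
  ∑ s ∈ Finset.range r, tent^[s + 1] t / 4 ^ (s + 1)

lemma tent_mem_Icc {t : ℝ} (ht : t ∈ Set.Icc (0 : ℝ) 1) : tent t ∈ Set.Icc (0 : ℝ) 1 := by
  obtain ⟨h0, h1⟩ := ht
  rw [tent, max_eq_left h0]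
  rcases le_total t (1 / 2) with h | h
  · rw [max_eq_right (by linarith)]; constructor <;> linarith
  · rw [max_eq_left (by linarith)]; constructor <;> linarith

lemma sub_sq_eq_tent {t : ℝ} (ht : t ∈ Set.Icc (0 : ℝ) 1) :
    t - t ^ 2 = tent t / 4 + (tent t - tent t ^ 2) / 4 := by
  obtain ⟨h0, h1⟩ := ht
  rw [tent, max_eq_left h0]
  rcases le_total t (1 / 2) with h | h
  · rw [max_eq_right (by linarith)]; ring
  · rw [max_eq_left (by linarith)]; ring

lemma iterate_tent_mem_Icc {t : ℝ} (ht : t ∈ Set.Icc (0 : ℝ) 1) (r : ℕ) :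
    tent^[r] t ∈ Set.Icc (0 : ℝ) 1 := by
  induction r with
  | zero => exact ht
  | succ r ih => rw [Function.iterate_succ_apply']; exact tent_mem_Icc ih

lemma sub_sq_eq_tentSum_add {t : ℝ} (ht : t ∈ Set.Icc (0 : ℝ) 1) (r : ℕ) :
    t - t ^ 2 = tentSum r t + (tent^[r] t - tent^[r] t ^ 2) / 4 ^ r := by
  induction r with
  | zero => simp [tentSum]
  | succ r ih =>
    rw [tentSum, Finset.sum_range_succ, ← tentSum, ih,
      sub_sq_eq_tent (iterate_tent_mem_Icc ht r), Function.iterate_succ_apply']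
    field_simp
    ring

lemma sub_sq_sub_tentSum_mem_Icc {t : ℝ} (ht : t ∈ Set.Icc (0 : ℝ) 1) (r : ℕ) :
    t - t ^ 2 - tentSum r t ∈ Set.Icc (0 : ℝ) ((1 / 4) ^ (r + 1)) := by
  obtain ⟨h0, h1⟩ := iterate_tent_mem_Icc ht r
  have h4 : (0 : ℝ) < 4 ^ r := by positivity
  rw [sub_sq_eq_tentSum_add ht r, add_sub_cancel_left]
  refine ⟨div_nonneg (by nlinarith) h4.le, ?_⟩
  rw [div_le_iff₀ h4, one_div_pow, one_div_mul_eq_div, pow_succ 4, div_mul_cancel_left₀ h4.ne']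
  nlinarith [sq_nonneg (tent^[r] t - 1 / 2)]

/-- Approximate multiplication, from the polarization identity and `tentSum`. -/
noncomputable def approxMul (r : ℕ) (u v : ℝ) : ℝ :=
  16 * (tentSum r ((u - v + 4) / 8) - tentSum r ((u + v + 4) / 8))

lemma abs_approxMul_sub_le {u v : ℝ} (hu : |u| ≤ 2) (hv : |v| ≤ 2) (m : ℕ) :
    |approxMul (m + 1) u v - u * v| ≤ (1 / 4) ^ m := by
  rw [abs_le] at hu hv
  obtain ⟨h1, h2⟩ := sub_sq_sub_tentSum_mem_Icc (t := (u - v + 4) / 8)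
    ⟨by linarith, by linarith⟩ (m + 1)
  obtain ⟨h3, h4⟩ := sub_sq_sub_tentSum_mem_Icc (t := (u + v + 4) / 8)
    ⟨by linarith, by linarith⟩ (m + 1)
  have hp : ((1 : ℝ) / 4) ^ (m + 1 + 1) = (1 / 4) ^ m / 16 := by ring
  rw [hp] at h2 h4
  rw [approxMul, abs_le]
  constructor <;> nlinarith

/-- Horner's scheme for `∑ i < n, c i * y ^ i` with approximate multiplications. -/
noncomputable def approxHorner (r : ℕ) (y : ℝ) : ℕ → (ℕ → ℝ) → ℝ
  | 0, _ => 0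
  | n + 1, c => c 0 + approxMul r y (approxHorner r y n fun i => c (i + 1))

lemma abs_approxHorner_sub_le {y : ℝ} (hy : |y| ≤ 1 / 4) {m : ℕ} (hm : 1 ≤ m) (n : ℕ)
    (c : ℕ → ℝ) (hc : ∀ i, |c i| ≤ 1) :
    |approxHorner (m + 1) y n c| ≤ 2 ∧
      |approxHorner (m + 1) y n c - ∑ i ∈ Finset.range n, c i * y ^ i| ≤ 2 * (1 / 4) ^ m := by
  induction n generalizing c with
  | zero => simp [approxHorner]
  | succ n ih =>
    obtain ⟨h1, h2⟩ := ih (fun i => c (i + 1)) fun i => hc _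
    rw [approxHorner]
    set p := approxHorner (m + 1) y n fun i => c (i + 1)
    set q := ∑ i ∈ Finset.range n, c (i + 1) * y ^ i with hq
    have hε : ((1 : ℝ) / 4) ^ m ≤ 1 / 4 :=
      (pow_le_pow_of_le_one (by norm_num) (by norm_num) hm).trans (by norm_num)
    have hmul := abs_approxMul_sub_le (hy.trans (by norm_num)) h1 m
    have hyp : |y * p| ≤ 1 / 2 := by
      rw [abs_mul]; nlinarith [abs_nonneg y, abs_nonneg p]
    have hypq : |y * (p - q)| ≤ (1 / 4) ^ m / 2 := by
      rw [abs_mul]; nlinarith [abs_nonneg y, abs_nonneg (p - q)]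
    have hsum : ∑ i ∈ Finset.range (n + 1), c i * y ^ i = c 0 + y * q := by
      rw [Finset.sum_range_succ', hq, Finset.mul_sum, add_comm]
      congr 1
      · simp
      · exact Finset.sum_congr rfl fun i _ => by ring
    have hc0 := hc 0
    rw [hsum]
    rw [mul_sub] at hypq
    rw [abs_le] at hmul hyp hypq hc0 ⊢
    rw [abs_le]
    refine ⟨⟨?_, ?_⟩, ?_, ?_⟩ <;> linarith

section Layers

variable {X : Type*}

lemma layerStep_tent (t s : X → ℝ) (c : ℝ) :
    LayerStep 4 (spanOne {t, s}) (spanOne {tent ∘ t, s + c • (tent ∘ t)}) := by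
  classical
  have ht : t ∈ spanOne {t, s} := mem_spanOne (by simp)
  have hs : s ∈ spanOne {t, s} := mem_spanOne (by simp)
  refine ⟨{t, t - (1 / 2 : ℝ) • 1, s, -s}, Finset.card_le_four, ?_, ?_⟩
  · intro g hg
    simp only [Finset.mem_insert, Finset.mem_singleton] at hg
    rcases hg with rfl | rfl | rfl | rfl
    · exact ht
    · exact sub_mem ht (Submodule.smul_mem _ _ (one_mem_spanOne _))
    · exact hs
    · exact neg_mem hs
  · set N : Finset (X → ℝ) := {t, t - (1 / 2 : ℝ) • 1, s, -s}
    have hT : tent ∘ t ∈ spanOne (relu '' (N : Set (X → ℝ))) := by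
      have : tent ∘ t = (2 : ℝ) • relu t - (4 : ℝ) • relu (t - (1 / 2 : ℝ) • 1) := by
        ext x; simp [tent, relu]
      rw [this]
      exact sub_mem (Submodule.smul_mem _ _ (relu_mem_spanOne (by simp [N])))
        (Submodule.smul_mem _ _ (relu_mem_spanOne (by simp [N])))
    have hS : s ∈ spanOne (relu '' (N : Set (X → ℝ))) := by
      rw [← relu_sub_relu_neg s]
      exact sub_mem (relu_mem_spanOne (by simp [N])) (relu_mem_spanOne (by simp [N]))
    refine spanOne_le (one_mem_spanOne _) ?_
    rintro g (rfl | rfl)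
    · exact hT
    · exact add_mem hS (Submodule.smul_mem _ _ hT)

lemma layerSteps_tentSum (z : X → ℝ) (r : ℕ) :
    LayerSteps 4 r (spanOne {z}) (spanOne {tentSum r ∘ z}) := by
  suffices h : LayerSteps 4 r (spanOne {z}) (spanOne {tent^[r] ∘ z, tentSum r ∘ z}) from
    h.mono le_rfl le_rfl (spanOne_mono (by simp))
  induction r with
  | zero =>
    refine spanOne_le (one_mem_spanOne _) ?_
    rintro g (rfl | rfl)
    · exact mem_spanOne rfl
    · convert zero_mem (spanOne {z})
      ext x; simp [tentSum]
  | succ r ih =>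
    have hsum : tentSum (r + 1) ∘ z =
        tentSum r ∘ z + (1 / 4 ^ (r + 1) : ℝ) • (tent ∘ tent^[r] ∘ z) := by
      ext x
      simp only [tentSum, Function.comp_apply, Finset.sum_range_succ _ r, Pi.add_apply,
        Pi.smul_apply, smul_eq_mul, Function.iterate_succ_apply']
      ring
    rw [hsum, Function.iterate_succ', Function.comp_assoc]
    exact ⟨_, ih, layerStep_tent _ _ _⟩

lemma layerSteps_approxMul (y p : X → ℝ) (c : ℝ) (r : ℕ) :
    LayerSteps 10 r (spanOne {y, p}) (spanOne {y, fun x => c + approxMul r (y x) (p x)}) := by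
  have hy : y ∈ spanOne {y, p} := mem_spanOne (by simp)
  have hp : p ∈ spanOne {y, p} := mem_spanOne (by simp)
  have h1 := one_mem_spanOne {y, p}
  let zm : X → ℝ := fun x => (y x - p x + 4) / 8
  let zp : X → ℝ := fun x => (y x + p x + 4) / 8
  have hzm : zm ∈ spanOne {y, p} := by
    have : zm = (1 / 8 : ℝ) • (y - p + (4 : ℝ) • 1) := by
      ext x; simp [zm]; ring
    rw [this]
    exact Submodule.smul_mem _ _ (add_mem (sub_mem hy hp) (Submodule.smul_mem _ _ h1))
  have hzp : zp ∈ spanOne {y, p} := by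
    have : zp = (1 / 8 : ℝ) • (y + p + (4 : ℝ) • 1) := by
      ext x; simp [zp]; ring
    rw [this]
    exact Submodule.smul_mem _ _ (add_mem (add_mem hy hp) (Submodule.smul_mem _ _ h1))
  have key := ((LayerSteps.refl y r).sup (layerSteps_tentSum zm r)).sup (layerSteps_tentSum zp r)
  refine key.mono (by norm_num) ?_ ?_
  · refine sup_le (sup_le ?_ ?_) ?_ <;> refine spanOne_le h1 ?_ <;> rintro _ rfl
    exacts [hy, hzm, hzp]
  · set V := spanOne {y} ⊔ spanOne {tentSum r ∘ zm} ⊔ spanOne {tentSum r ∘ zp}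
    have hyV : spanOne {y} ≤ V := le_sup_left.trans le_sup_left
    have hmV : spanOne {tentSum r ∘ zm} ≤ V := le_sup_right.trans le_sup_left
    have hpV : spanOne {tentSum r ∘ zp} ≤ V := le_sup_right
    have h1V : (1 : X → ℝ) ∈ V := hyV (one_mem_spanOne _)
    refine spanOne_le h1V ?_
    rintro g (rfl | rfl)
    · exact hyV (mem_spanOne rfl)
    · have : (fun x => c + approxMul r (y x) (p x)) =
          c • (1 : X → ℝ) + (16 : ℝ) • (tentSum r ∘ zm - tentSum r ∘ zp) := by
        ext x; simp [approxMul, zm, zp]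
      rw [this]
      exact add_mem (Submodule.smul_mem _ _ h1V)
        (Submodule.smul_mem _ _ (sub_mem (hmV (mem_spanOne rfl)) (hpV (mem_spanOne rfl))))

lemma layerSteps_approxHorner (y : X → ℝ) (r n : ℕ) (c : ℕ → ℝ) :
    LayerSteps 10 (n * r) (spanOne {y}) (spanOne {y, fun x => approxHorner r (y x) n c}) := by
  induction n generalizing c with
  | zero =>
    rw [Nat.zero_mul]
    refine spanOne_le (one_mem_spanOne _) ?_
    rintro g (rfl | rfl)
    · exact mem_spanOne rfl
    · exact zero_mem (spanOne {y})
  | succ n ih =>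
    rw [Nat.succ_mul]
    exact (ih fun i => c (i + 1)).trans (layerSteps_approxMul y _ (c 0) r)

end Layers

/-- `f` is approximated on `S` with geometric rate in `m` by networks of bounded width and depth
proportional to `m ^ 2`. -/
def HasExpApprox (f : ℝ → ℝ) (S : Set ℝ) : Prop :=
  ∃ (k K : ℕ) (C q : ℝ), 0 < C ∧ 0 < q ∧ q < 1 ∧ ∀ m : ℕ, 1 ≤ m → ∃ g : ℝ → ℝ,
    LayerSteps k (K * m ^ 2) (spanOne {id}) (spanOne {g}) ∧ ∀ x ∈ S, |f x - g x| ≤ C * q ^ m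

lemma HasExpApprox.mono {f : ℝ → ℝ} {S T : Set ℝ} (h : HasExpApprox f S) (hT : T ⊆ S) :
    HasExpApprox f T := by
  obtain ⟨k, K, C, q, hC, hq, hq1, h⟩ := h
  refine ⟨k, K, C, q, hC, hq, hq1, fun m hm => ?_⟩
  obtain ⟨g, hg, hg'⟩ := h m hm
  exact ⟨g, hg, fun x hx => hg' x (hT hx)⟩

/-- Adjacent intervals are glued through `f x = f (min x c) + f (max x c) - f c`. -/
lemma HasExpApprox.union_Icc {f : ℝ → ℝ} {a b c : ℝ} (h : HasExpApprox f (Set.Icc a c))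
    (h' : HasExpApprox f (Set.Icc c b)) (hac : a ≤ c) (hcb : c ≤ b) :
    HasExpApprox f (Set.Icc a b) := by
  classical
  obtain ⟨k₁, K₁, C₁, q₁, hC₁, hq₁, hq₁', h₁⟩ := h
  obtain ⟨k₂, K₂, C₂, q₂, hC₂, hq₂, hq₂', h₂⟩ := h'
  refine ⟨k₁ + 2 + (k₂ + 2) + 3, 1 + (K₁ + K₂), C₁ + C₂, max q₁ q₂, by positivity,
    lt_max_of_lt_left hq₁, max_lt hq₁' hq₂', fun m hm => ?_⟩
  obtain ⟨g₁, hg₁, hg₁'⟩ := h₁ m hm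
  obtain ⟨g₂, hg₂, hg₂'⟩ := h₂ m hm
  let u : ℝ → ℝ := fun x => min x c
  let v : ℝ → ℝ := fun x => max x c
  have hclamp : LayerSteps 3 1 (spanOne {id}) (spanOne {u} ⊔ spanOne {v}) := by
    refine ⟨_, le_rfl, {id, -id, id - c • 1}, Finset.card_le_three, ?_, ?_⟩
    · have hid : (id : ℝ → ℝ) ∈ spanOne {id} := mem_spanOne rfl
      intro g hg
      simp only [Finset.mem_insert, Finset.mem_singleton] at hg
      rcases hg with rfl | rfl | rfl
      · exact hid
      · exact neg_mem hid
      · exact sub_mem hid (Submodule.smul_mem _ _ (one_mem_spanOne _))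
    · set N : Finset (ℝ → ℝ) := {id, -id, id - c • 1}
      have hid : (id : ℝ → ℝ) ∈ spanOne (relu '' (N : Set (ℝ → ℝ))) := by
        rw [← relu_sub_relu_neg id]
        exact sub_mem (relu_mem_spanOne (by simp [N])) (relu_mem_spanOne (by simp [N]))
      have hc : relu (id - c • 1) ∈ spanOne (relu '' (N : Set (ℝ → ℝ))) :=
        relu_mem_spanOne (by simp [N])
      have hu : u = id - relu (id - c • 1) := by
        ext x
        rcases le_total x c with hx | hx <;> simp [u, relu, hx]
      have hv : v = relu (id - c • 1) + c • 1 := by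
        ext x
        rcases le_total x c with hx | hx <;> simp [v, relu, hx]
      refine sup_le (spanOne_le (one_mem_spanOne _) ?_) (spanOne_le (one_mem_spanOne _) ?_) <;>
        rintro _ rfl
      · rw [hu]; exact sub_mem hid hc
      · rw [hv]; exact add_mem hc (Submodule.smul_mem _ _ (one_mem_spanOne _))
  have hK₁ : K₁ * m ^ 2 ≤ (K₁ + K₂) * m ^ 2 := Nat.mul_le_mul_right _ (by omega)
  have hK₂ : K₂ * m ^ 2 ≤ (K₁ + K₂) * m ^ 2 := Nat.mul_le_mul_right _ (by omega)
  have hu := (hg₁.pad hK₁).comp u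
  have hv := (hg₂.pad hK₂).comp v
  simp only [map_funLeft_spanOne, Set.image_singleton, Function.id_comp] at hu hv
  let g : ℝ → ℝ := g₁ ∘ u + g₂ ∘ v - f c • 1
  have hg : LayerSteps (k₁ + 2 + (k₂ + 2)) ((K₁ + K₂) * m ^ 2) (spanOne {u} ⊔ spanOne {v})
      (spanOne {g}) := by
    refine (hu.sup hv).mono le_rfl le_rfl ?_
    have h1 : (1 : ℝ → ℝ) ∈ spanOne {g₁ ∘ u} ⊔ spanOne {g₂ ∘ v} :=
      Submodule.mem_sup_left (one_mem_spanOne _)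
    refine spanOne_le h1 ?_
    rintro _ rfl
    exact sub_mem (add_mem (Submodule.mem_sup_left (mem_spanOne rfl))
      (Submodule.mem_sup_right (mem_spanOne rfl))) (Submodule.smul_mem _ _ h1)
  have hpow : 1 ≤ m ^ 2 := Nat.one_le_pow _ _ hm
  refine ⟨g, ?_, fun x hx => ?_⟩
  · have := (hclamp.mono (show 3 ≤ k₁ + 2 + (k₂ + 2) + 1 by omega) le_rfl le_rfl).trans
      (hg.mono (show _ ≤ k₁ + 2 + (k₂ + 2) + 1 by omega) le_rfl le_rfl)
    exact this.pad (by rw [Nat.add_mul 1, one_mul]; omega)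
  · have e₁ := hg₁' (u x) ⟨le_min hx.1 hac, min_le_right _ _⟩
    have e₂ := hg₂' (v x) ⟨le_max_right _ _, max_le hx.2 hcb⟩
    have p₁ : q₁ ^ m ≤ max q₁ q₂ ^ m := pow_le_pow_left₀ hq₁.le (le_max_left _ _) m
    have p₂ : q₂ ^ m ≤ max q₁ q₂ ^ m := pow_le_pow_left₀ hq₂.le (le_max_right _ _) m
    have hf : f x - g x = (f (u x) - g₁ (u x)) + (f (v x) - g₂ (v x)) := by
      rcases le_total x c with hxc | hxc <;> simp [g, u, v, hxc] <;> ring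
    rw [hf, add_mul]
    exact (abs_add_le _ _).trans (add_le_add
      (e₁.trans (mul_le_mul_of_nonneg_left p₁ hC₁.le))
      (e₂.trans (mul_le_mul_of_nonneg_left p₂ hC₂.le)))

lemma exists_hasExpApprox_of_analyticAt {f : ℝ → ℝ} {x₀ : ℝ} (hf : AnalyticAt ℝ f x₀) :
    ∃ δ > 0, HasExpApprox f (Set.Icc (x₀ - δ) (x₀ + δ)) := by
  obtain ⟨p, r, hp⟩ := hf
  obtain ⟨ρ, hρ0, hρr⟩ := ENNReal.lt_iff_exists_nnreal_btwn.1 hp.r_pos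
  have hρ : (0 : ℝ) < ρ := by exact_mod_cast hρ0
  obtain ⟨q, ⟨hq0, hq1⟩, C, hC, hgeom⟩ := hp.uniform_geometric_approx hρr
  obtain ⟨M, hM, hcoef⟩ := p.norm_mul_pow_le_of_lt_radius (hρr.trans_le hp.r_le)
  let c : ℕ → ℝ := fun i => p.coeff i * ρ ^ i / M
  have hc : ∀ i, |c i| ≤ 1 := fun i => by
    have := hcoef i
    rw [p.norm_apply_eq_norm_coef, Real.norm_eq_abs] at this
    rw [abs_div, abs_mul, abs_of_pos hM, abs_of_pos (pow_pos hρ i), div_le_one hM]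
    exact this
  let y : ℝ → ℝ := fun x => (x - x₀) / ρ
  have hy : y ∈ spanOne {id} := by
    have : y = (1 / (ρ : ℝ)) • (id - x₀ • 1) := by
      ext x; simp [y]; ring
    rw [this]
    exact Submodule.smul_mem _ _ (sub_mem (mem_spanOne rfl)
      (Submodule.smul_mem _ _ (one_mem_spanOne _)))
  refine ⟨ρ / 4, by positivity, 10 + 2, 2, C + M * 2, max q (1 / 4), by positivity,
    lt_max_of_lt_left hq0, max_lt hq1 (by norm_num), fun m hm => ?_⟩
  let h : ℝ → ℝ := fun x => approxHorner (m + 1) (y x) m c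
  refine ⟨M • h, ?_, fun x hx => ?_⟩
  · refine LayerSteps.pad (m := m * (m + 1)) ?_ (by nlinarith)
    refine (layerSteps_approxHorner y (m + 1) m c).mono le_rfl ?_ ?_
    · refine spanOne_le (one_mem_spanOne _) ?_
      rintro _ rfl
      exact hy
    · refine spanOne_le (one_mem_spanOne _) ?_
      rintro _ rfl
      exact Submodule.smul_mem _ _ (mem_spanOne (by simp [h]))
  · have hx' : |x - x₀| ≤ ρ / 4 := abs_le.2 ⟨by linarith [hx.1], by linarith [hx.2]⟩
    have hyx : |y x| ≤ 1 / 4 := by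
      rw [abs_div, abs_of_pos hρ, div_le_iff₀ hρ]; linarith
    have e₁ := hgeom (x - x₀) (by
      rw [mem_ball_zero_iff, Real.norm_eq_abs]; linarith) m
    rw [add_sub_cancel, Real.norm_eq_abs] at e₁
    have e₂ := (abs_approxHorner_sub_le hyx hm m c hc).2
    have hsum : p.partialSum m (x - x₀) = M * ∑ i ∈ Finset.range m, c i * y x ^ i := by
      rw [FormalMultilinearSeries.partialSum, Finset.mul_sum]
      refine Finset.sum_congr rfl fun i _ => ?_
      rw [p.apply_eq_pow_smul_coeff, smul_eq_mul]
      simp only [c, y, div_pow]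
      field_simp
    have p₁ : q ^ m ≤ max q (1 / 4) ^ m := pow_le_pow_left₀ hq0.le (le_max_left _ _) m
    have p₂ : (1 / 4 : ℝ) ^ m ≤ max q (1 / 4) ^ m :=
      pow_le_pow_left₀ (by norm_num) (le_max_right _ _) m
    have hsplit : f x - (M • h) x = (f x - p.partialSum m (x - x₀)) -
        M * (h x - ∑ i ∈ Finset.range m, c i * y x ^ i) := by
      rw [hsum, Pi.smul_apply, smul_eq_mul]; ring
    have e₃ : |M * (h x - ∑ i ∈ Finset.range m, c i * y x ^ i)| ≤ M * (2 * (1 / 4) ^ m) := by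
      rw [abs_mul, abs_of_pos hM]
      exact mul_le_mul_of_nonneg_left e₂ hM.le
    rw [hsplit, add_mul]
    refine (abs_sub _ _).trans (add_le_add (e₁.trans (mul_le_mul_of_nonneg_left p₁ hC.le))
      (e₃.trans ?_))
    rw [mul_assoc]
    gcongr

lemma hasExpApprox_Icc_of_analyticOnNhd {f : ℝ → ℝ} {a b : ℝ} (hab : a ≤ b)
    (hf : AnalyticOnNhd ℝ f (Set.Icc a b)) : HasExpApprox f (Set.Icc a b) := by
  choose δ hδ h using fun x : Set.Icc a b => exists_hasExpApprox_of_analyticAt (hf x x.2)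
  obtain ⟨t, ht0, htm, ⟨N, hN⟩, ht⟩ := exists_monotone_Icc_subset_open_cover_Icc hab
    (c := fun x : Set.Icc a b => Subtype.val ⁻¹' Set.Ioo (x - δ x : ℝ) (x + δ x))
    (fun x => isOpen_Ioo.preimage continuous_subtype_val)
    (fun x _ => Set.mem_iUnion.2 ⟨x, by
      constructor <;> linarith [hδ x]⟩)
  have hstep : ∀ n, HasExpApprox f (Set.Icc (t n : ℝ) (t (n + 1))) := fun n => by
    obtain ⟨x, hx⟩ := ht n
    refine (h x).mono fun z hz => ?_
    exact Set.Ioo_subset_Icc_self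
      (hx (show (⟨z, (t n).2.1.trans hz.1, hz.2.trans (t (n + 1)).2.2⟩ : Set.Icc a b) ∈ _ from
        ⟨hz.1, hz.2⟩))
  have hall : ∀ n, HasExpApprox f (Set.Icc a (t n)) := by
    intro n
    induction n with
    | zero =>
      refine (hstep 0).mono ?_
      rw [ht0]
      exact Set.Icc_subset_Icc le_rfl (t 1).2.1
    | succ n ih => exact ih.union_Icc (hstep n) (t n).2.1 (htm n.le_succ)
  simpa only [hN N le_rfl] using hall N

end ReLUNet

/-- **Theorem (ReLU approximation of analytic functions).** If $f : [a,b] → ℝ$ admits a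
real-analytic extension to an open interval containing $[a,b]$, then there are $C, γ > 0$
(depending only on $f$) such that for every $L ∈ ℕ$ there is a ReLU network $Φ_L : ℝ → ℝ$
with $\sup_{x ∈ [a,b]} |f(x) - Φ_L(x)| ≤ C e^{-γ \sqrt{L}}$, depth $≤ C L$ and width $≤ C$. -/
theorem relu_approx_analytic (a b : ℝ) (hab : a ≤ b) (f : ℝ → ℝ)
    (hf : ∃ α β : ℝ, α < a ∧ b < β ∧
      ∃ F : ℝ → ℝ, AnalyticOnNhd ℝ F (Set.Ioo α β) ∧ ∀ x ∈ Set.Icc a b, F x = f x) :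
    ∃ C > (0 : ℝ), ∃ γ > (0 : ℝ), ∀ L : ℕ,
      ∃ Φ : ReLUNet 1 1,
        (∀ x ∈ Set.Icc a b, |f x - Φ.eval1 x| ≤ C * Real.exp (-γ * Real.sqrt L)) ∧
        (Φ.depth : ℝ) ≤ C * L ∧ (Φ.width : ℝ) ≤ C := by
  open ReLUNet in
  obtain ⟨α, β, hα, hβ, F, hF, hFf⟩ := hf
  have hF' : AnalyticOnNhd ℝ F (Set.Icc a b) :=
    hF.mono (Set.Icc_subset_Ioo hα hβ)
  obtain ⟨B, hB⟩ := isCompact_Icc.exists_bound_of_continuousOn hF'.continuousOn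
  obtain ⟨k, K, C, q, hC, hq0, hq1, happrox⟩ := hasExpApprox_Icc_of_analyticOnNhd hab hF'
  have hγ : 0 < -Real.log q := neg_pos.2 (Real.log_neg hq0 hq1)
  refine ⟨C / q + |B| + k + K, by positivity, -Real.log q, hγ, fun L => ?_⟩
  have hCq : 0 < C / q := div_pos hC hq0
  have hB0 := abs_nonneg B
  rcases Nat.eq_zero_or_pos L with rfl | hL
  · have hzero : LayerSteps k 0 (spanOne {id}) (spanOne {(0 : ℝ → ℝ)}) :=
      spanOne_le (one_mem_spanOne _) (by rintro _ rfl; exact zero_mem _)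
    obtain ⟨Φ, hd, hw, hΦ⟩ := exists_net_of_layerSteps hzero
    refine ⟨Φ, fun x hx => ?_, by simp [hd], ?_⟩
    · have := hB x hx
      rw [Real.norm_eq_abs] at this
      rw [hΦ, ← hFf x hx]
      simp only [Pi.zero_apply, sub_zero, CharP.cast_eq_zero, Real.sqrt_zero, mul_zero,
        Real.exp_zero, mul_one]
      have hk : (0 : ℝ) ≤ k := by positivity
      have hK : (0 : ℝ) ≤ K := by positivity
      linarith [le_abs_self B]
    · have hw' : (Φ.width : ℝ) ≤ k := by exact_mod_cast hw
      have hK : (0 : ℝ) ≤ K := by positivity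
      linarith
  · have hm : 1 ≤ Nat.sqrt L := Nat.sqrt_pos.2 hL
    obtain ⟨g, hg, hfg⟩ := happrox (Nat.sqrt L) hm
    obtain ⟨Φ, hd, hw, hΦ⟩ := exists_net_of_layerSteps hg
    have hk : (0 : ℝ) ≤ k := by positivity
    have hK : (0 : ℝ) ≤ K := by positivity
    refine ⟨Φ, fun x hx => ?_, ?_, ?_⟩
    · rw [hΦ, ← hFf x hx]
      have hsqrt : Real.sqrt L ≤ Nat.sqrt L + 1 := Real.sqrt_le_iff.2 ⟨by positivity, by
        exact_mod_cast (Nat.lt_succ_sqrt' L).le⟩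
      have hpow : q ^ Nat.sqrt L ≤ Real.exp (-(-Real.log q) * Real.sqrt L) / q := by
        rw [le_div_iff₀ hq0, ← pow_succ, neg_neg, ← Real.exp_log (pow_pos hq0 _), Real.log_pow,
          Real.exp_le_exp]
        push_cast
        nlinarith
      calc |F x - g x| ≤ C * q ^ Nat.sqrt L := hfg x hx
        _ ≤ C * (Real.exp (-(-Real.log q) * Real.sqrt L) / q) := by gcongr
        _ = C / q * Real.exp (-(-Real.log q) * Real.sqrt L) := by ring
        _ ≤ _ := by gcongr; linarith
    · have hd' : (Φ.depth : ℝ) ≤ K * L := by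
        rw [hd]
        exact_mod_cast Nat.mul_le_mul_left K (Nat.sqrt_le' L)
      refine hd'.trans ?_
      gcongr
      linarith
    · have hw' : (Φ.width : ℝ) ≤ k := by exact_mod_cast hw
      linarith
end

section
/- Let t > 1 and define U_t : [0,2π] → ℝ by U_t(x) = −sin(Ψ_t^{−1}(x)). Then there exists a constant C > 0 (depending only on t) such that for every ε > 0 there exists a ReLU neural network Φ_ε : ℝ → ℝ with sup_{x∈[0,2π]} |Φ_ε(x) − U_t(x)| ≤ ε, depth(Φ_ε) ≤ C·log(ε^{−1})² and width(Φ_ε) ≤ C. -/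
open scoped BigOperators

open Real

/-- The affine span of a list of feature functions: linear combinations of the features and `1`. -/
def affineSpanOf (S : List (ℝ → ℝ)) : Submodule ℝ (ℝ → ℝ) :=
  Submodule.span ℝ (insert 1 {f | f ∈ S})

/-- `Feature w L S` says that `S` is the list of neurons of the `L`-th hidden layer of some
ReLU network on `ℝ` all of whose hidden layers up to the `L`-th have at most `w` neurons. -/
inductive Feature (w : ℕ) : ℕ → List (ℝ → ℝ) → Prop
  | zero : Feature w 0 [id]
  | succ {L : ℕ} {S : List (ℝ → ℝ)} (G : List (ℝ → ℝ)) (hS : Feature w L S)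
      (hw : G.length ≤ w) (hG : ∀ g ∈ G, g ∈ affineSpanOf S) :
      Feature w (L + 1) (G.map fun g x => max (g x) 0)

lemma mem_affineSpanOf_of_mem {S : List (ℝ → ℝ)} {f : ℝ → ℝ} (hf : f ∈ S) :
    f ∈ affineSpanOf S :=
  Submodule.subset_span (Or.inr hf)

lemma const_mem_affineSpanOf (S : List (ℝ → ℝ)) (c : ℝ) : (fun _ => c) ∈ affineSpanOf S := by
  have h : (1 : ℝ → ℝ) ∈ affineSpanOf S := Submodule.subset_span (Or.inl rfl)
  convert (affineSpanOf S).smul_mem c h using 1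
  ext; simp

lemma affineSpanOf_mono {S T : List (ℝ → ℝ)} (h : S ⊆ T) : affineSpanOf S ≤ affineSpanOf T :=
  Submodule.span_mono (Set.insert_subset_insert fun _ hf => h hf)

lemma relu_mem_affineSpanOf {G : List (ℝ → ℝ)} {g : ℝ → ℝ} (hg : g ∈ G) :
    (fun x => max (g x) 0) ∈ affineSpanOf (G.map fun g x => max (g x) 0) :=
  mem_affineSpanOf_of_mem (List.mem_map_of_mem hg)

lemma mem_affineSpanOf_of_nonneg {G : List (ℝ → ℝ)} {g : ℝ → ℝ} (hg : g ∈ G)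
    (h : ∀ x, 0 ≤ g x) : g ∈ affineSpanOf (G.map fun g x => max (g x) 0) := by
  convert relu_mem_affineSpanOf hg using 2 with x
  exact (max_eq_left (h x)).symm

lemma mem_affineSpanOf_of_neg_mem {G : List (ℝ → ℝ)} {g : ℝ → ℝ} (hg : g ∈ G) (hg' : -g ∈ G) :
    g ∈ affineSpanOf (G.map fun g x => max (g x) 0) := by
  convert Submodule.sub_mem _ (relu_mem_affineSpanOf hg) (relu_mem_affineSpanOf hg') using 1
  ext x
  simp only [Pi.sub_apply, Pi.neg_apply]
  rcases le_total (g x) 0 with h | h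
  · rw [max_eq_right h, max_eq_left (by linarith)]; ring
  · rw [max_eq_left h, max_eq_right (by linarith)]; ring

lemma exists_coeff_of_mem_affineSpanOf {S : List (ℝ → ℝ)} {f : ℝ → ℝ}
    (hf : f ∈ affineSpanOf S) :
    ∃ (c : ℕ → ℝ) (b : ℝ), ∀ x, f x = ∑ j : Fin S.length, c j * S.getD j 0 x + b := by
  induction hf using Submodule.span_induction with
  | mem f hf =>
    rcases hf with rfl | hf
    · exact ⟨0, 1, by simp⟩
    · obtain ⟨i, hi, rfl⟩ := List.mem_iff_getElem.1 hf
      refine ⟨Pi.single i 1, 0, fun x => ?_⟩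
      rw [Finset.sum_eq_single (⟨i, hi⟩ : Fin S.length)]
      · simp [hi]
      · intro j _ hj
        have : (j : ℕ) ≠ i := fun h => hj (Fin.ext h)
        simp [this]
      · simp
  | zero => exact ⟨0, 0, by simp⟩
  | add f g _ _ hf hg =>
    obtain ⟨c, b, h⟩ := hf
    obtain ⟨c', b', h'⟩ := hg
    refine ⟨c + c', b + b', fun x => ?_⟩
    simp only [Pi.add_apply, h, h', add_mul, Finset.sum_add_distrib]
    ring
  | smul a f _ hf =>
    obtain ⟨c, b, h⟩ := hf
    refine ⟨a • c, a * b, fun x => ?_⟩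
    simp only [Pi.smul_apply, smul_eq_mul, h, mul_add, Finset.mul_sum, mul_assoc]

lemma Feature.exists_layers {w L : ℕ} {S : List (ℝ → ℝ)} (hS : Feature w L S) :
    ∃ T : ℕ → List (ℝ → ℝ), T 0 = [id] ∧ T L = S ∧ ∀ ℓ < L, (T (ℓ + 1)).length ≤ w ∧
      ∀ f ∈ T (ℓ + 1), ∃ g ∈ affineSpanOf (T ℓ), f = fun x => max (g x) 0 := by
  induction hS with
  | zero => exact ⟨fun _ => [id], rfl, rfl, by simp⟩
  | @succ L S G hS hw hG ih =>
    obtain ⟨T, h0, hL, hT⟩ := ih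
    refine ⟨fun ℓ => if ℓ ≤ L then T ℓ else G.map fun g x => max (g x) 0,
      by simp [h0], by simp, fun ℓ hℓ => ?_⟩
    rcases (Nat.lt_succ_iff.1 hℓ).lt_or_eq with h | rfl
    · simpa [h.le, Nat.succ_le_of_lt h] using hT ℓ h
    · simp only [le_refl, if_true, add_le_iff_nonpos_right, nonpos_iff_eq_zero, one_ne_zero,
        if_false, List.length_map, hw, true_and, hL]
      intro f hf
      obtain ⟨g, hg, rfl⟩ := List.mem_map.1 hf
      exact ⟨g, hG g hg, rfl⟩

/-- Any affine combination of the neurons of the last layer is realized by a ReLU network. -/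
lemma Feature.exists_reluNet {w L : ℕ} {S : List (ℝ → ℝ)} (hS : Feature w L S) {f : ℝ → ℝ}
    (hf : f ∈ affineSpanOf S) :
    ∃ Φ : ReLUNet 1 1, (∀ x, Φ.eval1 x = f x) ∧ Φ.depth = L ∧ Φ.width ≤ w := by
  obtain ⟨T, h0, hL, hT⟩ := hS.exists_layers
  obtain ⟨c', b', hf'⟩ := exists_coeff_of_mem_affineSpanOf hf
  have key : ∀ ℓ i, ∃ (c : ℕ → ℝ) (b : ℝ), ℓ < L → i < (T (ℓ + 1)).length → ∀ x,
      (T (ℓ + 1)).getD i 0 x =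
        max (∑ j : Fin (T ℓ).length, c j * (T ℓ).getD j 0 x + b) 0 := by
    intro ℓ i
    by_cases h : ℓ < L ∧ i < (T (ℓ + 1)).length
    · obtain ⟨g, hg, he⟩ := (hT ℓ h.1).2 _ (List.getElem_mem h.2)
      obtain ⟨c, b, hcb⟩ := exists_coeff_of_mem_affineSpanOf hg
      refine ⟨c, b, fun _ _ x => ?_⟩
      rw [List.getD_eq_getElem _ _ h.2, he, ← hcb]
    · exact ⟨0, 0, fun h1 h2 => absurd ⟨h1, h2⟩ h⟩
  choose c b hcb using key
  let Φ : ReLUNet 1 1 :=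
    { depth := L
      dims := fun ℓ => if ℓ ≤ L then (T ℓ).length else 1
      dims_in := by simp [h0]
      dims_out := by simp
      W := fun ℓ => Matrix.of fun i j => if ℓ < L then c ℓ i j else c' j
      b := fun ℓ i => if ℓ < L then b ℓ i else b' }
  have hdim : ∀ ℓ ≤ L, Φ.dims ℓ = (T ℓ).length := fun ℓ hℓ => by simp [Φ, hℓ]
  have hsum : ∀ ℓ ≤ L, ∀ F : ℕ → ℝ,
      ∑ j : Fin (Φ.dims ℓ), F j = ∑ j : Fin (T ℓ).length, F j := by
    intro ℓ hℓ F
    rw [← Finset.sum_range, ← Finset.sum_range, hdim ℓ hℓ]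
  have hhid : ∀ ℓ ≤ L, ∀ x i, Φ.hidden ℓ (fun _ => x) i = (T ℓ).getD i 0 x := by
    intro ℓ
    induction ℓ with
    | zero =>
      intro _ x i
      have hi : (i : ℕ) = 0 := by
        have := i.2
        simp only [hdim 0 (Nat.zero_le _), h0, List.length_singleton] at this
        omega
      simp [ReLUNet.hidden, h0, hi]
    | succ ℓ ih =>
      intro hℓ x i
      have hi : (i : ℕ) < (T (ℓ + 1)).length := (hdim (ℓ + 1) hℓ) ▸ i.2
      rw [hcb ℓ i hℓ hi x, ReLUNet.hidden]
      simp only [Matrix.mulVec, dotProduct, ih (by omega)]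
      rw [← hsum ℓ (by omega) fun j => c ℓ i j * (T ℓ).getD j 0 x]
      have : ℓ < L := hℓ
      simp [Φ, this]
  refine ⟨Φ, fun x => ?_, rfl, ?_⟩
  · simp only [ReLUNet.eval1, ReLUNet.eval, Matrix.mulVec, dotProduct]
    rw [hf', ← hL, ← hsum L le_rfl fun j => c' j * (T L).getD j 0 x]
    simp only [hhid Φ.depth le_rfl]
    simp [Φ]
  · refine Finset.sup_le fun ℓ hℓ => ?_
    obtain ⟨h1, h2⟩ := Finset.mem_Icc.1 hℓ
    rw [hdim ℓ h2]
    obtain ⟨k, rfl⟩ := Nat.exists_eq_add_of_le' h1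
    exact (hT k h2).1

/-- Two networks of equal depth can be run in parallel. -/
lemma Feature.exists_union {w w' L : ℕ} {S S' : List (ℝ → ℝ)} (hS : Feature w L S)
    (hS' : Feature w' L S') :
    ∃ T, Feature (w + w') L T ∧ S ⊆ T ∧ S' ⊆ T := by
  induction L generalizing S S' with
  | zero =>
    cases hS; cases hS'
    exact ⟨_, .zero, by simp, by simp⟩
  | succ L ih =>
    cases hS with
    | succ G hS hw hG =>
    cases hS' with
    | succ G' hS' hw' hG' =>
    obtain ⟨T, hT, h1, h2⟩ := ih hS hS'
    refine ⟨_, .succ (G ++ G') hT (by simp; omega) fun g hg => ?_, ?_, ?_⟩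
    · rcases List.mem_append.1 hg with hg | hg
      · exact affineSpanOf_mono h1 (hG g hg)
      · exact affineSpanOf_mono h2 (hG' g hg)
    · simp
    · simp

/-- The tent map on `[0, 1]`. -/
noncomputable def tentMap (p : ℝ) : ℝ := 2 * p - 4 * max (p - 1 / 2) 0

lemma tentMap_mem_Icc {p : ℝ} (hp : p ∈ Set.Icc (0 : ℝ) 1) : tentMap p ∈ Set.Icc (0 : ℝ) 1 := by
  obtain ⟨h0, h1⟩ := hp
  unfold tentMap
  rcases le_total (p - 1 / 2) 0 with h | h
  · rw [max_eq_right h]; constructor <;> linarith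
  · rw [max_eq_left h]; constructor <;> linarith

lemma mul_one_sub_eq_tentMap (p : ℝ) :
    p * (1 - p) = (tentMap p + tentMap p * (1 - tentMap p)) / 4 := by
  unfold tentMap
  rcases le_total (p - 1 / 2) 0 with h | h
  · rw [max_eq_right h]; ring
  · rw [max_eq_left h]; ring

lemma tentMap_comp_mem_affineSpanOf {G : List (ℝ → ℝ)} {p : ℝ → ℝ} (hp : p ∈ G)
    (hp' : (fun x => p x - 1 / 2) ∈ G) (h0 : ∀ x, 0 ≤ p x) :
    (fun x => tentMap (p x)) ∈ affineSpanOf (G.map fun g x => max (g x) 0) :=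
  Submodule.sub_mem _ (Submodule.smul_mem _ 2 (mem_affineSpanOf_of_nonneg hp h0))
    (Submodule.smul_mem _ 4 (relu_mem_affineSpanOf hp'))

/-- Iterating the tent map `m` times approximates the difference of the parabolas
`4 q (1 - q) - 4 p (1 - p)` with accuracy `4⁻ᵐ`. -/
lemma Feature.exists_parabola_sub (m : ℕ) {L : ℕ} {S : List (ℝ → ℝ)} {u p q r : ℝ → ℝ} (κ : ℝ)
    (hS : Feature 8 L S) (hu : u ∈ affineSpanOf S) (hp : p ∈ affineSpanOf S)
    (hq : q ∈ affineSpanOf S) (hr : r ∈ affineSpanOf S)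
    (hp' : ∀ x, p x ∈ Set.Icc (0 : ℝ) 1) (hq' : ∀ x, q x ∈ Set.Icc (0 : ℝ) 1) :
    ∃ T s, Feature 8 (L + m) T ∧ u ∈ affineSpanOf T ∧ s ∈ affineSpanOf T ∧
      ∀ x, |s x - (r x + κ * (4 * (q x * (1 - q x)) - 4 * (p x * (1 - p x))))| ≤
        |κ| * (1 / 4) ^ m := by
  induction m generalizing L S p q r κ with
  | zero =>
    refine ⟨S, r, hS, hu, hr, fun x => ?_⟩
    obtain ⟨hp0, hp1⟩ := hp' x
    obtain ⟨hq0, hq1⟩ := hq' x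
    rw [show r x - (r x + κ * (4 * (q x * (1 - q x)) - 4 * (p x * (1 - p x)))) =
      κ * (4 * (p x * (1 - p x)) - 4 * (q x * (1 - q x))) by ring, abs_mul, pow_zero]
    refine mul_le_mul_of_nonneg_left (abs_le.2 ⟨?_, ?_⟩) (abs_nonneg _)
    · nlinarith [sq_nonneg (q x - 1 / 2), mul_nonneg hp0 (sub_nonneg.2 hp1)]
    · nlinarith [sq_nonneg (p x - 1 / 2), mul_nonneg hq0 (sub_nonneg.2 hq1)]
  | succ m ih =>
    let G : List (ℝ → ℝ) :=
      [u, -u, r, -r, p, fun x => p x - 1 / 2, q, fun x => q x - 1 / 2]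
    have hG : ∀ g ∈ G, g ∈ affineSpanOf S := by
      have hc := const_mem_affineSpanOf S (1 / 2)
      simp only [G, List.forall_mem_cons]
      exact ⟨hu, neg_mem hu, hr, neg_mem hr, hp, sub_mem hp hc, hq, sub_mem hq hc, by simp⟩
    have hp2 : (fun x => tentMap (p x)) ∈ affineSpanOf (G.map fun g x => max (g x) 0) :=
      tentMap_comp_mem_affineSpanOf (by simp [G]) (by simp [G]) fun x => (hp' x).1
    have hq2 : (fun x => tentMap (q x)) ∈ affineSpanOf (G.map fun g x => max (g x) 0) :=
      tentMap_comp_mem_affineSpanOf (by simp [G]) (by simp [G]) fun x => (hq' x).1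
    have hu2 : u ∈ affineSpanOf (G.map fun g x => max (g x) 0) :=
      mem_affineSpanOf_of_neg_mem (by simp [G]) (by simp [G])
    have hr2 : r ∈ affineSpanOf (G.map fun g x => max (g x) 0) :=
      mem_affineSpanOf_of_neg_mem (by simp [G]) (by simp [G])
    obtain ⟨T, s, hT, huT, hsT, hs⟩ := ih (κ / 4) (.succ G hS (by simp [G]) hG) hu2 hp2 hq2
      (add_mem hr2 (Submodule.smul_mem _ κ (sub_mem hq2 hp2)))
      (fun x => tentMap_mem_Icc (hp' x)) (fun x => tentMap_mem_Icc (hq' x))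
    refine ⟨T, s, by convert hT using 1; ring, huT, hsT, fun x => ?_⟩
    convert hs x using 1
    · rw [mul_one_sub_eq_tentMap (p x), mul_one_sub_eq_tentMap (q x)]
      simp only [Pi.add_apply, Pi.smul_apply, Pi.sub_apply, smul_eq_mul]
      congr 1
      ring
    · rw [abs_div, abs_of_pos (four_pos : (0 : ℝ) < 4)]
      ring

/-- Approximate multiplication by a ReLU network of fixed width. -/
lemma Feature.exists_mul (m : ℕ) {L : ℕ} {S : List (ℝ → ℝ)} {u v : ℝ → ℝ}
    (hS : Feature 8 L S) (hu : u ∈ affineSpanOf S) (hv : v ∈ affineSpanOf S)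
    (hu' : ∀ x, |u x| ≤ 1) (hv' : ∀ x, |v x| ≤ 1) :
    ∃ T s, Feature 8 (L + m) T ∧ u ∈ affineSpanOf T ∧ s ∈ affineSpanOf T ∧
      ∀ x, |s x - u x * v x| ≤ (1 / 4) ^ m := by
  have hp : (fun x => 4⁻¹ * (u x + v x) + 1 / 2) ∈ affineSpanOf S :=
    add_mem (Submodule.smul_mem _ 4⁻¹ (add_mem hu hv)) (const_mem_affineSpanOf S _)
  have hq : (fun x => 4⁻¹ * (u x - v x) + 1 / 2) ∈ affineSpanOf S :=
    add_mem (Submodule.smul_mem _ 4⁻¹ (sub_mem hu hv)) (const_mem_affineSpanOf S _)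
  obtain ⟨T, s, hT, huT, hsT, hs⟩ := hS.exists_parabola_sub m 1 hu hp hq
    (const_mem_affineSpanOf S 0)
    (fun x => by
      have := abs_le.1 (hu' x); have := abs_le.1 (hv' x)
      constructor <;> linarith)
    (fun x => by
      have := abs_le.1 (hu' x); have := abs_le.1 (hv' x)
      constructor <;> linarith)
  refine ⟨T, s, hT, huT, hsT, fun x => ?_⟩
  convert hs x using 1
  · congr 1; ring
  · simp

/-- Approximate Horner scheme: `F j = a j + u * F (j + 1)` is evaluated by `n` approximate
multiplications. -/
lemma Feature.exists_horner {a : ℕ → ℝ} {F : ℕ → ℝ → ℝ} {u : ℝ → ℝ} {m : ℕ} (hm : m ≠ 0)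
    (ha : ∀ j, |a j| ≤ 1 / 4) (hu' : ∀ x, |u x| ≤ 1 / 2) (hF : ∀ j x, |F j x| ≤ 1 / 2)
    (hrec : ∀ j x, F j x = a j + u x * F (j + 1) x) {L : ℕ} {S : List (ℝ → ℝ)}
    (hS : Feature 8 L S) (hu : u ∈ affineSpanOf S) (n j : ℕ) :
    ∃ T g, Feature 8 (L + n * m) T ∧ u ∈ affineSpanOf T ∧ g ∈ affineSpanOf T ∧
      (∀ x, |g x| ≤ 1) ∧ ∀ x, |g x - F j x| ≤ 1 / 2 * (1 / 2) ^ n + 2 * (1 / 4) ^ m := by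
  have hm4 : ((1 : ℝ) / 4) ^ m ≤ 1 / 4 := pow_le_of_le_one (by norm_num) (by norm_num) hm
  induction n generalizing j with
  | zero =>
    refine ⟨S, fun _ => 0, by simpa using hS, hu, const_mem_affineSpanOf S 0, by simp, fun x => ?_⟩
    have := hF j x
    have : (0 : ℝ) ≤ (1 / 4) ^ m := by positivity
    simp only [zero_sub, abs_neg, pow_zero]
    linarith
  | succ n ih =>
    obtain ⟨T, g, hT, huT, hgT, hg, hgF⟩ := ih (j + 1)
    obtain ⟨T', s, hT', huT', hsT', hs⟩ := hT.exists_mul m huT hgT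
      (fun x => (hu' x).trans (by norm_num)) hg
    refine ⟨T', fun x => a j + s x, by convert hT' using 1; ring, huT',
      add_mem (const_mem_affineSpanOf T' _) hsT', fun x => ?_, fun x => ?_⟩
    · have h1 : |u x * g x| ≤ 1 / 2 * 1 := by
        rw [abs_mul]
        exact mul_le_mul (hu' x) (hg x) (abs_nonneg _) (by norm_num)
      have h2 := abs_le.1 (hs x)
      have h3 := abs_le.1 (ha j)
      have h4 := abs_le.1 h1
      exact abs_le.2 ⟨by linarith, by linarith⟩
    · have h1 : |u x * (g x - F (j + 1) x)| ≤
          1 / 2 * (1 / 2 * (1 / 2) ^ n + 2 * (1 / 4) ^ m) := by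
        rw [abs_mul]
        exact mul_le_mul (hu' x) (hgF x) (abs_nonneg _) (by norm_num)
      calc |a j + s x - F j x| = |(s x - u x * g x) + u x * (g x - F (j + 1) x)| := by
            rw [hrec j x]; congr 1; ring
        _ ≤ _ := abs_add_le _ _
        _ ≤ _ := add_le_add (hs x) h1
        _ = _ := by ring

/-- `f` composed with the projection to `[a, b]` is approximated with accuracy `O(2⁻ⁿ)` by ReLU
networks of depth `1 + n * (n + 1)` and bounded width. -/
def ReLUApproxOn (f : ℝ → ℝ) (a b : ℝ) : Prop :=
  ∃ (w : ℕ) (K : ℝ), ∀ n : ℕ, ∃ S g, Feature w (1 + n * (n + 1)) S ∧ g ∈ affineSpanOf S ∧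
    ∀ x, |g x - f (max a (min x b))| ≤ K * (1 / 2) ^ n

lemma ReLUApproxOn.trans {f : ℝ → ℝ} {a b c : ℝ} (hab : a ≤ b) (hbc : b ≤ c)
    (h₁ : ReLUApproxOn f a b) (h₂ : ReLUApproxOn f b c) : ReLUApproxOn f a c := by
  obtain ⟨w₁, K₁, h₁⟩ := h₁
  obtain ⟨w₂, K₂, h₂⟩ := h₂
  refine ⟨w₁ + w₂, K₁ + K₂, fun n => ?_⟩
  obtain ⟨S₁, g₁, hS₁, hg₁, hf₁⟩ := h₁ n
  obtain ⟨S₂, g₂, hS₂, hg₂, hf₂⟩ := h₂ n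
  obtain ⟨T, hT, hT₁, hT₂⟩ := hS₁.exists_union hS₂
  refine ⟨T, fun x => g₁ x + g₂ x - f b, hT, sub_mem (add_mem (affineSpanOf_mono hT₁ hg₁)
    (affineSpanOf_mono hT₂ hg₂)) (const_mem_affineSpanOf T _), fun x => ?_⟩
  have key : f (max a (min x c)) = f (max a (min x b)) + f (max b (min x c)) - f b := by
    rcases le_total x b with h | h
    · rw [min_eq_left (h.trans hbc), min_eq_left h, max_eq_left h]; ring
    · rw [min_eq_right h, max_eq_right hab, max_eq_right (le_min h hbc),
        max_eq_right (hab.trans (le_min h hbc))]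
      ring
  calc |g₁ x + g₂ x - f b - f (max a (min x c))|
      = |(g₁ x - f (max a (min x b))) + (g₂ x - f (max b (min x c)))| := by
        rw [key]; congr 1; ring
    _ ≤ _ := abs_add_le _ _
    _ ≤ _ := add_le_add (hf₁ x) (hf₂ x)
    _ = _ := by ring

lemma exists_feature_one_clamp {a b : ℝ} (hab : a ≤ b) :
    ∃ S, Feature 8 1 S ∧ (fun x => max a (min x b)) ∈ affineSpanOf S := by
  let G : List (ℝ → ℝ) := [fun x => x - a, fun x => x - b]
  refine ⟨_, Feature.succ G .zero (by simp [G]) ?_, ?_⟩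
  · simp only [G, List.forall_mem_cons]
    have h : (fun x => x) ∈ affineSpanOf [id] := mem_affineSpanOf_of_mem (List.mem_singleton_self _)
    exact ⟨sub_mem h (const_mem_affineSpanOf _ a), sub_mem h (const_mem_affineSpanOf _ b), by simp⟩
  · have h1 := relu_mem_affineSpanOf (G := G) (g := fun x => x - a) (by simp [G])
    have h2 := relu_mem_affineSpanOf (G := G) (g := fun x => x - b) (by simp [G])
    convert sub_mem (add_mem (const_mem_affineSpanOf _ a) h1) h2 using 1
    ext x
    simp only [Pi.add_apply, Pi.sub_apply]
    rcases le_total x a with h | h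
    · rw [min_eq_left (h.trans hab), max_eq_left h, max_eq_right (by linarith),
        max_eq_right (by linarith)]
      ring
    · rcases le_total x b with h' | h'
      · rw [min_eq_left h', max_eq_right h, max_eq_left (by linarith), max_eq_right (by linarith)]
        ring
      · rw [min_eq_right h', max_eq_right hab, max_eq_left (by linarith),
          max_eq_left (by linarith)]
        ring

/-- A function given by a power series on `[a, b]` is well approximated there by ReLU networks. -/
lemma reluApproxOn_of_hasSum {f : ℝ → ℝ} {c : ℕ → ℝ} {x₀ ρ M a b : ℝ} (hρ : 0 < ρ)
    (hM : ∀ k, |c k * ρ ^ k| ≤ M) (hab : a ≤ b) (ha : x₀ - ρ / 2 ≤ a) (hb : b ≤ x₀ + ρ / 2)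
    (hf : ∀ x ∈ Set.Icc a b, HasSum (fun k => c k * (x - x₀) ^ k) (f x)) :
    ReLUApproxOn f a b := by
  obtain ⟨N, hN, hN'⟩ : ∃ N > 0, ∀ k, |c k * ρ ^ k| ≤ N :=
    ⟨max M 1, by positivity, fun k => (hM k).trans (le_max_left _ _)⟩
  have hclamp : ∀ x, max a (min x b) ∈ Set.Icc a b :=
    fun x => ⟨le_max_left _ _, max_le hab (min_le_right _ _)⟩
  let u : ℝ → ℝ := fun x => ρ⁻¹ * (max a (min x b) - x₀)
  let α : ℕ → ℝ := fun k => c k * ρ ^ k / (4 * N)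
  let F : ℕ → ℝ → ℝ := fun j x => ∑' k, α (k + j) * u x ^ k
  have hu : ∀ x, |u x| ≤ 1 / 2 := fun x => by
    have hx := hclamp x
    have : |max a (min x b) - x₀| ≤ ρ / 2 := abs_le.2 ⟨by linarith [hx.1], by linarith [hx.2]⟩
    rw [abs_mul, abs_of_pos (inv_pos.2 hρ)]
    calc ρ⁻¹ * |max a (min x b) - x₀| ≤ ρ⁻¹ * (ρ / 2) := by gcongr
      _ = 1 / 2 := by field_simp
  have hα : ∀ k, |α k| ≤ 1 / 4 := fun k => by
    rw [abs_div, abs_of_pos (by positivity : (0 : ℝ) < 4 * N), div_le_iff₀ (by positivity)]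
    linarith [hN' k]
  have hgeo : HasSum (fun k : ℕ => (1 / 4 : ℝ) * (1 / 2) ^ k) (1 / 2) := by
    have h := hasSum_geometric_two.mul_left (1 / 4 : ℝ)
    rwa [show (1 / 4 : ℝ) * 2 = 1 / 2 by norm_num] at h
  have hbound : ∀ j x k, ‖α (k + j) * u x ^ k‖ ≤ (1 / 4 : ℝ) * (1 / 2) ^ k := fun j x k => by
    rw [Real.norm_eq_abs, abs_mul, abs_pow]
    have := hu x
    have := hα (k + j)
    gcongr
  have hsum : ∀ j x, Summable fun k => α (k + j) * u x ^ k := fun j x =>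
    .of_norm_bounded hgeo.summable (hbound j x)
  have hF : ∀ j x, |F j x| ≤ 1 / 2 := fun j x => tsum_of_norm_bounded hgeo (hbound j x)
  have hrec : ∀ j x, F j x = α j + u x * F (j + 1) x := fun j x => by
    simp only [F]
    rw [(hsum j x).tsum_eq_zero_add, ← tsum_mul_left]
    congr 1
    · simp
    · refine tsum_congr fun k => ?_
      rw [add_right_comm, add_assoc]
      ring
  have hF0 : ∀ x, f (max a (min x b)) = 4 * N * F 0 x := fun x => by
    rw [← (hf _ (hclamp x)).tsum_eq, ← tsum_mul_left]
    refine tsum_congr fun k => ?_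
    simp only [α, u, add_zero, mul_pow, inv_pow]
    field_simp
  obtain ⟨S, hS, hclampS⟩ := exists_feature_one_clamp hab
  have huS : u ∈ affineSpanOf S :=
    Submodule.smul_mem _ _ (sub_mem hclampS (const_mem_affineSpanOf S x₀))
  refine ⟨8, 4 * N * 3, fun n => ?_⟩
  obtain ⟨T, g, hT, -, hg, -, hgF⟩ :=
    Feature.exists_horner n.succ_ne_zero hα hu hF hrec hS huS n 0
  refine ⟨T, (4 * N) • g, hT, Submodule.smul_mem _ _ hg, fun x => ?_⟩
  have h4 : (1 / 4 : ℝ) ^ (n + 1) ≤ (1 / 2) ^ n :=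
    calc (1 / 4 : ℝ) ^ (n + 1) ≤ (1 / 4) ^ n :=
          pow_le_pow_of_le_one (by norm_num) (by norm_num) n.le_succ
      _ ≤ (1 / 2) ^ n := by gcongr; norm_num
  have h2 : (0 : ℝ) < (1 / 2) ^ n := by positivity
  rw [hF0, Pi.smul_apply, smul_eq_mul, ← mul_sub, abs_mul,
    abs_of_pos (by positivity : (0 : ℝ) < 4 * N), mul_assoc (4 * N)]
  gcongr
  have := hgF x
  simp only [Nat.succ_eq_add_one] at this
  linarith

lemma AnalyticAt.exists_reluApproxOn {φ f : ℝ → ℝ} {x₀ : ℝ} {s : Set ℝ} (hφ : AnalyticAt ℝ φ x₀)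
    (hf : ∀ᶠ x in nhdsWithin x₀ s, f x = φ x) :
    ∃ δ > 0, ∀ a b, a ≤ b → x₀ - δ ≤ a → b ≤ x₀ + δ → Set.Icc a b ⊆ s → ReLUApproxOn f a b := by
  obtain ⟨p, hp⟩ := hφ
  have h1 := hasFPowerSeriesAt_iff'.1 hp
  rw [eventually_nhdsWithin_iff] at hf
  obtain ⟨δ, hδ, hball⟩ := Metric.eventually_nhds_iff.1 (h1.and hf)
  have hsum : HasSum (fun k => (δ / 2) ^ k • p.coeff k) (φ (x₀ + δ / 2)) := by
    have := (hball (y := x₀ + δ / 2)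
      (by rw [Real.dist_eq, add_sub_cancel_left, abs_of_pos] <;> linarith)).1
    simpa using this
  obtain ⟨M, hM⟩ := hsum.summable.tendsto_atTop_zero.abs.bddAbove_range
  refine ⟨δ / 4, by positivity, fun a b hab ha hb hs => ?_⟩
  refine reluApproxOn_of_hasSum (c := p.coeff) (x₀ := x₀) (ρ := δ / 2) (M := M) (by positivity)
    (fun k => ?_) hab (by linarith) (by linarith) fun x hx => ?_
  · rw [mul_comm]
    exact hM ⟨k, rfl⟩
  · obtain ⟨h1, h2⟩ := hball (y := x) (by
      rw [Real.dist_eq]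
      exact abs_lt.2 ⟨by linarith [hx.1], by linarith [hx.2]⟩)
    rw [h2 (hs hx)]
    simpa [mul_comm] using h1

lemma reluApproxOn_of_forall_analyticAt {f : ℝ → ℝ} {a b : ℝ} (hab : a ≤ b)
    (hf : ∀ x₀ ∈ Set.Icc a b, ∃ φ : ℝ → ℝ, AnalyticAt ℝ φ x₀ ∧
      ∀ᶠ x in nhdsWithin x₀ (Set.Icc a b), f x = φ x) : ReLUApproxOn f a b := by
  have hloc : ∀ x₀ : Set.Icc a b, ∃ δ > 0, ∀ a' b', a' ≤ b' → (x₀ : ℝ) - δ ≤ a' → b' ≤ x₀ + δ →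
      Set.Icc a' b' ⊆ Set.Icc a b → ReLUApproxOn f a' b' := fun x₀ => by
    obtain ⟨φ, hφ, hfφ⟩ := hf x₀ x₀.2
    exact hφ.exists_reluApproxOn hfφ
  choose δ hδ hloc using hloc
  obtain ⟨τ, h0, hmono, ⟨N, hN⟩, hsub⟩ := exists_monotone_Icc_subset_open_cover_Icc hab
    (c := fun x₀ => Metric.ball x₀ (δ x₀)) (fun _ => Metric.isOpen_ball)
    (fun x _ => Set.mem_iUnion.2 ⟨x, Metric.mem_ball_self (hδ x)⟩)
  have hpiece : ∀ n, ReLUApproxOn f (τ n) (τ (n + 1)) := fun n => by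
    obtain ⟨x₀, hx₀⟩ := hsub n
    have hle := hmono n.le_succ
    have h1 := hx₀ (Set.left_mem_Icc.2 hle)
    have h2 := hx₀ (Set.right_mem_Icc.2 hle)
    rw [Metric.mem_ball, Subtype.dist_eq, Real.dist_eq, abs_lt] at h1 h2
    exact hloc x₀ _ _ hle (by linarith) (by linarith)
      (Set.Icc_subset_Icc (τ n).2.1 (τ (n + 1)).2.2)
  have hall : ∀ n, ReLUApproxOn f (τ 0) (τ (n + 1)) := fun n => by
    induction n with
    | zero => exact hpiece 0
    | succ n ih => exact ih.trans (hmono (Nat.zero_le _)) (hmono (Nat.le_succ _)) (hpiece _)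
  have := hall N
  rwa [h0, hN (N + 1) N.le_succ] at this

/-- A continuous right inverse of an analytic function with nonzero derivative is locally
analytic. -/
lemma AnalyticAt.exists_analyticAt_eq_rightInverse {f g : ℝ → ℝ} {x₀ : ℝ} {s : Set ℝ}
    (hf : AnalyticAt ℝ f (g x₀)) (hf' : deriv f (g x₀) ≠ 0) (hg : ContinuousWithinAt g s x₀)
    (hfg : ∀ x ∈ s, f (g x) = x) (hx₀ : x₀ ∈ s) :
    ∃ φ : ℝ → ℝ, AnalyticAt ℝ φ x₀ ∧ ∀ᶠ x in nhdsWithin x₀ s, g x = φ x := by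
  have h1 := hf.analyticAt_localInverse hf'
  rw [hfg x₀ hx₀] at h1
  refine ⟨_, h1, ?_⟩
  filter_upwards [hg.eventually (hf.hasStrictDerivAt.eventually_left_inverse hf'),
    self_mem_nhdsWithin] with x hx hxs
  rw [hfg x hxs] at hx
  exact hx.symm

lemma exists_pow_half_le_log (K : ℝ) {ε₀ : ℝ} (h0 : 0 < ε₀) (h1 : ε₀ < 1) :
    ∃ B : ℝ, ∀ ε, 0 < ε → ε < ε₀ →
      ∃ n : ℕ, K * (1 / 2) ^ n ≤ ε ∧ (n + 1 : ℝ) ≤ B * Real.log ε⁻¹ := by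
  obtain ⟨K', hK', hKK'⟩ : ∃ K' ≥ (1 : ℝ), K ≤ K' := ⟨max K 1, le_max_right _ _, le_max_left _ _⟩
  have hl0 : 0 < Real.log ε₀⁻¹ := Real.log_pos ((one_lt_inv₀ h0).2 h1)
  have hl2 : 0 < Real.log 2 := Real.log_pos one_lt_two
  have hlK : 0 ≤ Real.log K' := Real.log_nonneg hK'
  refine ⟨(Real.log K' / Real.log ε₀⁻¹ + 1) / Real.log 2 + 2 / Real.log ε₀⁻¹,
    fun ε hε hlt => ?_⟩
  have hl : Real.log ε₀⁻¹ ≤ Real.log ε⁻¹ :=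
    Real.log_le_log (inv_pos.2 h0) (inv_anti₀ hε hlt.le)
  have hr : 1 ≤ Real.log ε⁻¹ / Real.log ε₀⁻¹ := (one_le_div hl0).2 hl
  have hy : 0 ≤ (Real.log K' + Real.log ε⁻¹) / Real.log 2 := by
    have := hl0.trans_le hl
    positivity
  refine ⟨⌈(Real.log K' + Real.log ε⁻¹) / Real.log 2⌉₊, ?_, ?_⟩
  · have h := Nat.le_ceil ((Real.log K' + Real.log ε⁻¹) / Real.log 2)
    rw [div_le_iff₀ hl2] at h
    generalize ⌈(Real.log K' + Real.log ε⁻¹) / Real.log 2⌉₊ = n at h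
    have h2 : K' * ε⁻¹ ≤ 2 ^ n := by
      rw [← Real.log_le_log_iff (by positivity) (by positivity), Real.log_mul (by positivity)
        (by positivity), Real.log_pow]
      exact h
    rw [one_div, inv_pow, mul_inv_le_iff₀ (by positivity)]
    rw [mul_inv_le_iff₀ hε] at h2
    linarith
  · have h := (Nat.ceil_lt_add_one hy).le
    have h3 : Real.log K' ≤ Real.log K' * (Real.log ε⁻¹ / Real.log ε₀⁻¹) :=
      le_mul_of_one_le_right hlK hr
    calc (⌈(Real.log K' + Real.log ε⁻¹) / Real.log 2⌉₊ + 1 : ℝ)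
        ≤ (Real.log K' + Real.log ε⁻¹) / Real.log 2 + 2 * 1 := by linarith
      _ ≤ (Real.log K' * (Real.log ε⁻¹ / Real.log ε₀⁻¹) + Real.log ε⁻¹) / Real.log 2 +
          2 * (Real.log ε⁻¹ / Real.log ε₀⁻¹) := by gcongr
      _ = _ := by ring

lemma abs_sin_sub_le {t α z : ℝ} (ht : 1 < t) (hα : α = 1 / (2 * (π + t)))
    (hz : z ∈ Set.Icc (-π) π) : |sin z - α * (z + t * sin z)| ≤ 1 - α / 2 := by
  have hπ := Real.pi_pos
  have hα0 : 0 < α := by rw [hα]; positivity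
  have hαπ : α * π + α * t = 1 / 2 := by rw [hα]; field_simp
  have hα1 : α ≤ 1 / 2 := by nlinarith
  have key : ∀ y, 0 ≤ y → y ≤ π → |sin y - α * (y + t * sin y)| ≤ 1 - α / 2 := by
    intro y h0 h1
    have hs0 := Real.sin_nonneg_of_nonneg_of_le_pi h0 h1
    have hs1 := Real.sin_le_one y
    have hsy := Real.sin_le h0
    have h2 : 0 ≤ α * y := by positivity
    have h3 : 0 ≤ α * (t * sin y) := by positivity
    have h4 : α * y ≤ α * π := by gcongr
    have h5 : α * (t * sin y) ≤ α * t := by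
      rw [← mul_assoc]; exact mul_le_of_le_one_right (by positivity) hs1
    refine abs_le.2 ⟨by linarith, ?_⟩
    rcases le_total y (1 / 2) with h | h
    · linarith
    · have : α * (1 / 2) ≤ α * y := by gcongr
      linarith
  rcases le_total 0 z with h | h
  · exact key z h hz.2
  · have := key (-z) (by linarith) (by linarith [hz.1])
    rw [Real.sin_neg, ← abs_neg] at this
    convert this using 2
    ring

lemma mul_cos_lt_one {t x : ℝ} (ht : 0 < t) (hx : x ∈ Set.Ioo 0 π) (h : x = t * sin x) :
    t * cos x < 1 := by
  rcases lt_or_ge x (π / 2) with h2 | h2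
  · have hc : 0 < cos x := Real.cos_pos_of_mem_Ioo ⟨by linarith [hx.1, Real.pi_pos], h2⟩
    have h3 := Real.lt_tan hx.1 h2
    rw [Real.tan_eq_sin_div_cos, lt_div_iff₀ hc] at h3
    have h4 : t * (x * cos x) < t * sin x := by gcongr
    rw [← h] at h4
    have : x * (t * cos x) < x * 1 := by linarith
    exact lt_of_mul_lt_mul_left this hx.1.le
  · have : cos x ≤ 0 := Real.cos_nonpos_of_pi_div_two_le_of_le h2 (by linarith [hx.2, Real.pi_pos])
    nlinarith

lemma cos_le_cos_of_mem_Icc_two_pi_sub {x y : ℝ} (hx : 0 ≤ x) (hy : y ∈ Set.Icc x (2 * π - x)) :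
    cos y ≤ cos x := by
  rcases le_total y π with h | h
  · exact Real.cos_le_cos_of_nonneg_of_le_pi hx h hy.1
  · rw [← Real.cos_two_pi_sub y]
    exact Real.cos_le_cos_of_nonneg_of_le_pi hx (by linarith) (by linarith [hy.2])

lemma mul_sub_le_of_cos_le {t k a b y z : ℝ} (ht : 0 ≤ t)
    (hk : ∀ y ∈ Set.Icc a b, cos y ≤ k) (hy : y ∈ Set.Icc a b) (hz : z ∈ Set.Icc a b)
    (hyz : y ≤ z) : (1 - t * k) * (z - y) ≤ (z - t * sin z) - (y - t * sin y) := by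
  have hd : ∀ y, HasDerivAt (fun y => y - t * sin y) (1 - t * cos y) y := fun y =>
    (hasDerivAt_id y).sub ((Real.hasDerivAt_sin y).const_mul t)
  refine (convex_Icc a b).mul_sub_le_image_sub_of_le_deriv (f := fun y => y - t * sin y)
    (by fun_prop) (fun y _ => (hd y).differentiableAt.differentiableWithinAt)
    (fun y hy => ?_) y hy z hz hyz
  rw [(hd y).deriv]
  have := hk y (interior_subset hy)
  gcongr

/-- **Corollary (ReLU approximation of the Burgers profile).** Let $t > 1$, let $x_t ∈ (0,π)$
solve $x_t = t \sin x_t$ and let $Ψ_t^{-1} : [0,2π] → [x_t, 2π - x_t]$ be the inverse of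
$Ψ_t(x_0) = x_0 - t \sin x_0$. Then there is $C > 0$ (depending only on $t$) such that for every
$ε > 0$ there is a ReLU network $Φ_ε : ℝ → ℝ$ with
$\sup_{x ∈ [0,2π]} |Φ_ε(x) - U_t(x)| ≤ ε$ where $U_t(x) = -\sin(Ψ_t^{-1}(x))$, of depth
$≤ C \log(ε^{-1})^2$ and width $≤ C$. -/
theorem relu_approx_burgers_profile (t : ℝ) (ht : 1 < t)
    (xt : ℝ) (hxt : xt ∈ Set.Ioo 0 π) (hxteq : xt = t * sin xt)
    (Ψinv : ℝ → ℝ)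
    (hΨinv : ∀ x ∈ Set.Icc (0 : ℝ) (2 * π),
      Ψinv x ∈ Set.Icc xt (2 * π - xt) ∧ Ψinv x - t * sin (Ψinv x) = x) :
    ∃ C > (0 : ℝ), ∀ ε : ℝ, 0 < ε →
      ∃ Φ : ReLUNet 1 1,
        (∀ x ∈ Set.Icc (0 : ℝ) (2 * π), |Φ.eval1 x - (-sin (Ψinv x))| ≤ ε) ∧
        (Φ.depth : ℝ) ≤ C * Real.log ε⁻¹ ^ 2 ∧
        (Φ.width : ℝ) ≤ C := by
  have ht0 : 0 < t := one_pos.trans ht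
  have hc : 0 < 1 - t * cos xt := sub_pos.2 (mul_cos_lt_one ht0 hxt hxteq)
  have hcos : ∀ y ∈ Set.Icc xt (2 * π - xt), cos y ≤ cos xt :=
    fun y => cos_le_cos_of_mem_Icc_two_pi_sub hxt.1.le
  have hlip : ∀ x ∈ Set.Icc (0 : ℝ) (2 * π), ∀ y ∈ Set.Icc (0 : ℝ) (2 * π),
      (1 - t * cos xt) * |Ψinv x - Ψinv y| ≤ |x - y| := by
    intro x hx y hy
    obtain ⟨hx1, hx2⟩ := hΨinv x hx
    obtain ⟨hy1, hy2⟩ := hΨinv y hy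
    rcases le_total (Ψinv x) (Ψinv y) with h | h
    · have := mul_sub_le_of_cos_le ht0.le hcos hx1 hy1 h
      rw [hx2, hy2] at this
      rw [abs_sub_comm, abs_of_nonneg (sub_nonneg.2 h), abs_sub_comm]
      exact this.trans (le_abs_self _)
    · have := mul_sub_le_of_cos_le ht0.le hcos hy1 hx1 h
      rw [hx2, hy2] at this
      rw [abs_of_nonneg (sub_nonneg.2 h)]
      exact this.trans (le_abs_self _)
  have hcont : ContinuousOn Ψinv (Set.Icc 0 (2 * π)) := by
    refine (LipschitzOnWith.of_dist_le_mul (K := (1 - t * cos xt)⁻¹.toNNReal)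
      fun x hx y hy => ?_).continuousOn
    rw [Real.dist_eq, Real.dist_eq, Real.coe_toNNReal _ (by positivity), ← div_eq_inv_mul, le_div_iff₀ hc, mul_comm]
    exact hlip x hx y hy
  have happrox : ReLUApproxOn (fun x => -sin (Ψinv x)) 0 (2 * π) := by
    refine reluApproxOn_of_forall_analyticAt (by positivity) fun x₀ hx₀ => ?_
    have hd : HasDerivAt (fun y => y - t * sin y) (1 - t * cos (Ψinv x₀)) (Ψinv x₀) :=
      (hasDerivAt_id _).sub ((Real.hasDerivAt_sin _).const_mul t)
    have hd0 : deriv (fun y => y - t * sin y) (Ψinv x₀) ≠ 0 := by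
      rw [hd.deriv]
      have := mul_le_mul_of_nonneg_left (hcos _ (hΨinv x₀ hx₀).1) ht0.le
      exact ne_of_gt (by linarith)
    obtain ⟨φ, hφ, he⟩ := AnalyticAt.exists_analyticAt_eq_rightInverse
      (f := fun y => y - t * sin y)
      (by fun_prop) hd0 (hcont x₀ hx₀) (fun x hx => (hΨinv x hx).2) hx₀
    refine ⟨fun x => -sin (φ x), by fun_prop, ?_⟩
    filter_upwards [he] with x hx
    rw [hx]
  obtain ⟨w, K, hK⟩ := happrox
  obtain ⟨α, hα⟩ : ∃ α, α = 1 / (2 * (π + t)) := ⟨_, rfl⟩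
  have hα0 : 0 < α := by rw [hα]; have := Real.pi_pos; positivity
  have hα1 : α < 1 := by
    have := Real.pi_pos
    rw [hα, div_lt_one (by positivity)]
    linarith
  obtain ⟨B, hB⟩ := exists_pow_half_le_log K (ε₀ := 1 - α / 2) (by linarith) (by linarith)
  refine ⟨B ^ 2 + w + 1, by positivity, fun ε hε => ?_⟩
  have hw : (w : ℝ) ≤ B ^ 2 + w + 1 := by nlinarith [sq_nonneg B]
  rcases lt_or_ge ε (1 - α / 2) with hlt | hge
  · obtain ⟨n, hn, hn'⟩ := hB ε hε hlt
    obtain ⟨S, g, hS, hg, hgU⟩ := hK n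
    obtain ⟨Φ, hΦ, hdepth, hwidth⟩ := hS.exists_reluNet hg
    refine ⟨Φ, fun x hx => ?_, ?_, le_trans (by exact_mod_cast hwidth) hw⟩
    · have := hgU x
      rw [min_eq_left hx.2, max_eq_right hx.1] at this
      rw [hΦ]
      exact this.trans hn
    · rw [hdepth]
      push_cast
      calc (1 + n * (n + 1) : ℝ) ≤ (n + 1) ^ 2 := by nlinarith [(Nat.cast_nonneg n : (0 : ℝ) ≤ n)]
        _ ≤ (B * Real.log ε⁻¹) ^ 2 := by gcongr
        _ = B ^ 2 * Real.log ε⁻¹ ^ 2 := mul_pow _ _ _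
        _ ≤ _ := by
          gcongr
          linarith [(Nat.cast_nonneg w : (0 : ℝ) ≤ w)]
  · have hf : (fun x => α * (x - π)) ∈ affineSpanOf [id] :=
      Submodule.smul_mem _ α (sub_mem (mem_affineSpanOf_of_mem (List.mem_singleton_self _))
        (const_mem_affineSpanOf _ π))
    obtain ⟨Φ, hΦ, hdepth, hwidth⟩ := (Feature.zero (w := w)).exists_reluNet hf
    refine ⟨Φ, fun x hx => ?_, ?_, le_trans (by exact_mod_cast hwidth) hw⟩
    · obtain ⟨⟨h1, h2⟩, h3⟩ := hΨinv x hx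
      refine le_trans ?_ hge
      have h4 := abs_sin_sub_le ht hα (z := Ψinv x - π)
        ⟨by linarith [hxt.1], by linarith [hxt.1]⟩
      rw [Real.sin_sub_pi, ← abs_neg] at h4
      rw [hΦ]
      refine (congrArg abs ?_).trans_le h4
      linear_combination (-α) * h3
    · rw [hdepth, Nat.cast_zero]
      positivity
end

section
/- Let t > 1 and define U : [−2π, 2π] → ℝ by U(x) = U_t(x + 2π) for x < 0 and U(x) = U_t(x) for x ≥ 0, where U_t(x) = −sin(Ψ_t^{−1}(x)). Then there exists a constant C = C(t) > 0 such that for every ε ∈ (0, 1/2] there exists a ReLU neural network Φ_ε : ℝ → ℝ with depth(Φ_ε) ≤ C·log(ε^{−1})², width(Φ_ε) ≤ C, and ‖Φ_ε − U‖_{L¹([−2π,2π])} ≤ ε. -/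
open scoped BigOperators

section ShallowLayers

variable {ι κ : Type*} [Fintype ι] [Fintype κ]

/-- A self-map of `κ → ℝ` given by a ReLU network with one hidden layer indexed by `ι`. -/
def IsShallow (ι : Type*) [Fintype ι] (G : (κ → ℝ) → κ → ℝ) : Prop :=
  ∃ (A : ι → κ → ℝ) (b : ι → ℝ) (B : κ → ι → ℝ) (c : κ → ℝ),
    ∀ v i, G v i = ∑ j, B i j * max (∑ l, A j l * v l + b j) 0 + c i

/-- A map whose components are an affine form plus a multiple of a difference of two
rectified affine forms is shallow, with four neurons per component. -/
theorem isShallow_of_components [DecidableEq κ] {G : (κ → ℝ) → κ → ℝ}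
    (hG : ∀ i, ∃ (a p q : κ → ℝ) (a₀ p₀ q₀ β : ℝ), ∀ v, G v i = (∑ l, a l * v l + a₀) +
      β * (max (∑ l, p l * v l + p₀) 0 - max (∑ l, q l * v l + q₀) 0)) :
    IsShallow (κ × Fin 4) G := by
  choose a p q a₀ p₀ q₀ β hG using hG
  refine ⟨fun j => ![a j.1, -a j.1, p j.1, q j.1] j.2,
    fun j => ![a₀ j.1, -a₀ j.1, p₀ j.1, q₀ j.1] j.2,
    fun i j => if j.1 = i then ![1, -1, β i, -β i] j.2 else 0, fun _ => 0, fun v i => ?_⟩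
  have hsub : ∀ y : ℝ, y = max y 0 - max (-y) 0 := fun y => by
    rcases le_total y 0 with h | h
    · rw [max_eq_right h, max_eq_left (by linarith)]; ring
    · rw [max_eq_left h, max_eq_right (by linarith)]; ring
  rw [Fintype.sum_prod_type, Finset.sum_eq_single i]
  · simp only [Fin.sum_univ_four, if_true]
    rw [hG, hsub (∑ l, a i l * v l + a₀ i)]
    simp [Finset.sum_neg_distrib]
    have : -a₀ i + -∑ l, a i l * v l = -∑ l, a i l * v l + -a₀ i := by ring
    rw [this]
    ring
  · intro j _ hj
    simp [hj]
  · simp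

/-- Successive application of the layers `F 0, F 1, …`. -/
def iterLayers (F : ℕ → (κ → ℝ) → κ → ℝ) : ℕ → (κ → ℝ) → κ → ℝ
  | 0, v => v
  | k + 1, v => F k (iterLayers F k v)

namespace ReLUNet

/-- The affine map applied to the state in front of layer `ℓ`: linear part. The last one is
the projection to the coordinate `o`. -/
noncomputable def preWeight [DecidableEq κ] (n : ℕ) (A : ℕ → ι → κ → ℝ) (o : κ)
    (ℓ p : ℕ) (i : κ) : ℝ :=
  if h : ℓ < n ∧ p < Fintype.card ι then A ℓ ((Fintype.equivFin ι).symm ⟨p, h.2⟩) i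
  else if i = o then 1 else 0

/-- The affine map applied to the state in front of layer `ℓ`: constant part. -/
noncomputable def preBias (n : ℕ) (b : ℕ → ι → ℝ) (ℓ p : ℕ) : ℝ :=
  if h : ℓ < n ∧ p < Fintype.card ι then b ℓ ((Fintype.equivFin ι).symm ⟨p, h.2⟩) else 0

/-- The affine map recovering the state from the activations of layer `ℓ`: linear part. -/
noncomputable def postWeight (B : ℕ → κ → ι → ℝ) (e : κ → ℝ) : ℕ → κ → ℕ → ℝ
  | 0, i, _ => e i
  | k + 1, i, q =>
    if h : q < Fintype.card ι then B k i ((Fintype.equivFin ι).symm ⟨q, h⟩) else 0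

/-- The affine map recovering the state from the activations of layer `ℓ`: constant part. -/
def postBias (c : ℕ → κ → ℝ) (f : κ → ℝ) : ℕ → κ → ℝ
  | 0 => f
  | k + 1 => c k

/-- The network which composes `n` shallow maps of `κ → ℝ`, after an affine embedding of the
input and before the projection to the coordinate `o`. -/
noncomputable def ofShallow [DecidableEq κ] (n : ℕ) (A : ℕ → ι → κ → ℝ) (b : ℕ → ι → ℝ)
    (B : ℕ → κ → ι → ℝ) (c : ℕ → κ → ℝ) (e f : κ → ℝ) (o : κ) : ReLUNet 1 1 where
  depth := n
  dims ℓ := if ℓ = 0 then 1 else if ℓ ≤ n then Fintype.card ι else 1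
  dims_in := by simp
  dims_out := by simp
  W ℓ := Matrix.of fun p q => ∑ i, preWeight n A o ℓ p i * postWeight B e ℓ i q
  b ℓ p := ∑ i, preWeight n A o ℓ p i * postBias c f ℓ i + preBias n b ℓ p

section

variable [DecidableEq κ] {n : ℕ} {A : ℕ → ι → κ → ℝ} {b : ℕ → ι → ℝ}
    {B : ℕ → κ → ι → ℝ} {c : ℕ → κ → ℝ} {e f : κ → ℝ} {o : κ}

theorem ofShallow_W_apply (ℓ : ℕ) (p : Fin ((ofShallow n A b B c e f o).dims (ℓ + 1)))
    (q : Fin ((ofShallow n A b B c e f o).dims ℓ)) : (ofShallow n A b B c e f o).W ℓ p q =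
      ∑ i, preWeight n A o ℓ p i * postWeight B e ℓ i q := rfl

theorem ofShallow_b_apply (ℓ : ℕ) (p : Fin ((ofShallow n A b B c e f o).dims (ℓ + 1))) :
    (ofShallow n A b B c e f o).b ℓ p =
      ∑ i, preWeight n A o ℓ p i * postBias c f ℓ i + preBias n b ℓ p := rfl

theorem ofShallow_preactivation {ℓ : ℕ} {x : Fin 1 → ℝ} {s : κ → ℝ}
    (hs : ∀ i, ∑ q : Fin ((ofShallow n A b B c e f o).dims ℓ), postWeight B e ℓ i q *
      (ofShallow n A b B c e f o).hidden ℓ x q +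
      postBias c f ℓ i = s i) (p : Fin ((ofShallow n A b B c e f o).dims (ℓ + 1))) :
    ((ofShallow n A b B c e f o).W ℓ).mulVec ((ofShallow n A b B c e f o).hidden ℓ x) p +
      (ofShallow n A b B c e f o).b ℓ p =
      ∑ i, preWeight n A o ℓ p i * s i + preBias n b ℓ p := by
  simp only [← hs, Matrix.mulVec, dotProduct, mul_add, Finset.mul_sum, Finset.sum_add_distrib]
  rw [Finset.sum_comm]
  simp only [ofShallow_W_apply, ofShallow_b_apply, Finset.sum_mul, mul_assoc, add_assoc]

theorem ofShallow_state {F : ℕ → (κ → ℝ) → κ → ℝ}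
    (hF : ∀ k v i, F k v i = ∑ j, B k i j * max (∑ l, A k j l * v l + b k j) 0 + c k i)
    (x : ℝ) {ℓ : ℕ} (hℓ : ℓ ≤ n) (i : κ) :
    ∑ q : Fin ((ofShallow n A b B c e f o).dims ℓ), postWeight B e ℓ i q *
      (ofShallow n A b B c e f o).hidden ℓ (fun _ => x) q +
      postBias c f ℓ i = iterLayers F ℓ (fun i => e i * x + f i) i := by
  induction ℓ generalizing i with
  | zero =>
    have hd : (ofShallow n A b B c e f o).dims 0 = 1 := rfl
    simp only [hidden, postWeight, postBias, iterLayers]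
    rw [← (finCongr hd).symm.sum_comp]
    simp
  | succ k ih =>
    have ih' := ih (by omega)
    have hd : (ofShallow n A b B c e f o).dims (k + 1) = Fintype.card ι := by
      simp [ofShallow, hℓ]
    have hk : k < n := hℓ
    simp only [hidden, ofShallow_preactivation ih', iterLayers, hF, postBias]
    congr 1
    rw [← (Fintype.equivFin ι).symm.sum_comp, ← (finCongr hd).sum_comp]
    refine Finset.sum_congr rfl fun q _ => ?_
    have hq : (q : ℕ) < Fintype.card ι := hd ▸ q.2
    simp [postWeight, preWeight, preBias, hk, hq]
    rfl

theorem ofShallow_eval1 {F : ℕ → (κ → ℝ) → κ → ℝ}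
    (hF : ∀ k v i, F k v i = ∑ j, B k i j * max (∑ l, A k j l * v l + b k j) 0 + c k i)
    (x : ℝ) : (ofShallow n A b B c e f o).eval1 x =
      iterLayers F n (fun i => e i * x + f i) o := by
  have h := ofShallow_preactivation (A := A) (b := b) (o := o)
    (ofShallow_state (A := A) (b := b) (e := e) (f := f) (o := o) hF x le_rfl)
    (finCongr (ofShallow n A b B c e f o).dims_out.symm 0)
  refine h.trans ?_
  simp [preWeight, preBias]

theorem ofShallow_width_le : (ofShallow n A b B c e f o).width ≤ Fintype.card ι := by
  refine Finset.sup_le fun ℓ hℓ => ?_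
  obtain ⟨h1, h2⟩ := Finset.mem_Icc.1 hℓ
  have h2 : ℓ ≤ n := h2
  simp [ofShallow, h2, Nat.one_le_iff_ne_zero.1 h1]

end

end ReLUNet

/-- `g` is an affine map followed by `n` shallow maps. -/
def IsDeep (ι : Type*) [Fintype ι] (n : ℕ) (g : ℝ → κ → ℝ) : Prop :=
  ∃ (F : ℕ → (κ → ℝ) → κ → ℝ) (e f : κ → ℝ), (∀ k, IsShallow ι (F k)) ∧
    ∀ x, g x = iterLayers F n fun i => e i * x + f i

theorem isDeep_affine (e f : κ → ℝ) : IsDeep ι 0 fun x i => e i * x + f i :=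
  ⟨fun _ _ _ => 0, e, f, fun _ => ⟨0, 0, 0, 0, by simp⟩, fun _ => rfl⟩

theorem IsDeep.comp {n : ℕ} {g : ℝ → κ → ℝ} {G : (κ → ℝ) → κ → ℝ} (hG : IsShallow ι G)
    (hg : IsDeep ι n g) : IsDeep ι (n + 1) fun x => G (g x) := by
  obtain ⟨F, e, f, hF, hgF⟩ := hg
  refine ⟨Function.update F n G, e, f, fun k => ?_, fun x => ?_⟩
  · rcases eq_or_ne k n with rfl | hk
    · simpa using hG
    · simpa [hk] using hF k
  · have key : ∀ k ≤ n, ∀ v, iterLayers (Function.update F n G) k v = iterLayers F k v := by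
      intro k
      induction k with
      | zero => intro _ _; rfl
      | succ k ih =>
        intro hk v
        simp only [iterLayers, ih (by omega)]
        rw [Function.update_of_ne (by omega)]
    simp only [iterLayers, key n le_rfl, Function.update_self, hgF]

theorem IsDeep.exists_reLUNet [DecidableEq κ] {n : ℕ} {g : ℝ → κ → ℝ} (hg : IsDeep ι n g)
    (o : κ) : ∃ Φ : ReLUNet 1 1, Φ.depth = n ∧ Φ.width ≤ Fintype.card ι ∧
      ∀ x, Φ.eval1 x = g x o := by
  obtain ⟨F, e, f, hF, hgF⟩ := hg
  choose A b B c hF using hF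
  refine ⟨ReLUNet.ofShallow n A b B c e f o, rfl, ReLUNet.ofShallow_width_le, fun x => ?_⟩
  rw [ReLUNet.ofShallow_eval1 hF, hgF]

end ShallowLayers

open Real MeasureTheory

section Bisection

/-- The continuous piecewise linear ramp from `0` at `0` to `1` at `1`. -/
def ramp (z : ℝ) : ℝ := max z 0 - max (z - 1) 0

theorem ramp_of_nonpos {z : ℝ} (hz : z ≤ 0) : ramp z = 0 := by
  rw [ramp, max_eq_right hz, max_eq_right (by linarith), sub_zero]

theorem ramp_of_one_le {z : ℝ} (hz : 1 ≤ z) : ramp z = 1 := by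
  rw [ramp, max_eq_left (by linarith), max_eq_left (by linarith)]; ring

/-- Multiplication of `z ∈ [-2, 2]` by a bit `b ∈ {0, 1}`. -/
def gate (b z : ℝ) : ℝ := max (z + 2 * b - 2) 0 - max (-z + 2 * b - 2) 0

theorem gate_zero {z : ℝ} (hz : |z| ≤ 2) : gate 0 z = 0 := by
  obtain ⟨h1, h2⟩ := abs_le.1 hz
  rw [gate, max_eq_right (by linarith), max_eq_right (by linarith), sub_zero]

theorem gate_one (z : ℝ) : gate 1 z = z := by
  rcases le_total z 0 with h | h
  · rw [gate, max_eq_right (by linarith), max_eq_left (by linarith)]; ring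
  · rw [gate, max_eq_left (by linarith), max_eq_right (by linarith)]; ring

/-- Periodise the input `v 0` and subtract the left end point `a`. -/
noncomputable def foldInput (a δ : ℝ) (v : Fin 4 → ℝ) : Fin 4 → ℝ :=
  ![v 0 + 2 * π * ramp (-v 0 / δ) - a, v 1, v 2, v 3]

/-- On a state `![x - y, sin y, cos y, _]`, write into the last coordinate the soft indicator of
`y + h - t * sin (y + h) ≤ x`. -/
noncomputable def bisectCompare (t δ h : ℝ) (v : Fin 4 → ℝ) : Fin 4 → ℝ :=
  ![v 0, v 1, v 2, ramp ((v 0 - h + t * (v 1 * cos h + v 2 * sin h)) / δ)]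

/-- On a state `![x - y, sin y, cos y, b]`, replace `y` by `y + b * h`. -/
noncomputable def bisectUpdate (h : ℝ) (v : Fin 4 → ℝ) : Fin 4 → ℝ :=
  ![v 0 - h * v 3, v 1 + gate (v 3) (v 1 * cos h + v 2 * sin h - v 1),
    v 2 + gate (v 3) (v 2 * cos h - v 1 * sin h - v 2), v 3]

/-- Clip `-v 1` to `[-1, 1]`. -/
def clipNeg (v : Fin 4 → ℝ) : Fin 4 → ℝ :=
  ![v 0, max (-v 1 + 1) 0 - max (-v 1 - 1) 0 - 1, v 2, v 3]

theorem isShallow_foldInput (a δ : ℝ) : IsShallow (Fin 4 × Fin 4) (foldInput a δ) := by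
  refine isShallow_of_components fun i => ?_
  fin_cases i
  · refine ⟨![1, 0, 0, 0], ![-1 / δ, 0, 0, 0], ![-1 / δ, 0, 0, 0], -a, 0, -1, 2 * π,
      fun v => ?_⟩
    simp [foldInput, ramp, Fin.sum_univ_four]
    ring_nf
  · exact ⟨![0, 1, 0, 0], 0, 0, 0, 0, 0, 0, fun v => by simp [foldInput, Fin.sum_univ_four]⟩
  · exact ⟨![0, 0, 1, 0], 0, 0, 0, 0, 0, 0, fun v => by simp [foldInput, Fin.sum_univ_four]⟩
  · exact ⟨![0, 0, 0, 1], 0, 0, 0, 0, 0, 0, fun v => by simp [foldInput, Fin.sum_univ_four]⟩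

theorem isShallow_bisectCompare (t δ h : ℝ) :
    IsShallow (Fin 4 × Fin 4) (bisectCompare t δ h) := by
  refine isShallow_of_components fun i => ?_
  fin_cases i
  · exact ⟨![1, 0, 0, 0], 0, 0, 0, 0, 0, 0, fun v => by simp [bisectCompare, Fin.sum_univ_four]⟩
  · exact ⟨![0, 1, 0, 0], 0, 0, 0, 0, 0, 0, fun v => by simp [bisectCompare, Fin.sum_univ_four]⟩
  · exact ⟨![0, 0, 1, 0], 0, 0, 0, 0, 0, 0, fun v => by simp [bisectCompare, Fin.sum_univ_four]⟩
  · refine ⟨0, ![1 / δ, t * cos h / δ, t * sin h / δ, 0],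
      ![1 / δ, t * cos h / δ, t * sin h / δ, 0], 0, -h / δ, -h / δ - 1, 1, fun v => ?_⟩
    simp [bisectCompare, ramp, Fin.sum_univ_four]
    ring_nf

theorem isShallow_bisectUpdate (h : ℝ) : IsShallow (Fin 4 × Fin 4) (bisectUpdate h) := by
  refine isShallow_of_components fun i => ?_
  fin_cases i
  · refine ⟨![1, 0, 0, -h], 0, 0, 0, 0, 0, 0, fun v => ?_⟩
    simp [bisectUpdate, Fin.sum_univ_four]
    ring
  · refine ⟨![0, 1, 0, 0], ![0, cos h - 1, sin h, 2], ![0, 1 - cos h, -sin h, 2], 0, -2, -2, 1,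
      fun v => ?_⟩
    simp [bisectUpdate, gate, Fin.sum_univ_four]
    ring_nf
  · refine ⟨![0, 0, 1, 0], ![0, -sin h, cos h - 1, 2], ![0, sin h, 1 - cos h, 2], 0, -2, -2, 1,
      fun v => ?_⟩
    simp [bisectUpdate, gate, Fin.sum_univ_four]
    ring_nf
  · exact ⟨![0, 0, 0, 1], 0, 0, 0, 0, 0, 0, fun v => by simp [bisectUpdate, Fin.sum_univ_four]⟩

theorem isShallow_clipNeg : IsShallow (Fin 4 × Fin 4) clipNeg := by
  refine isShallow_of_components fun i => ?_
  fin_cases i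
  · exact ⟨![1, 0, 0, 0], 0, 0, 0, 0, 0, 0, fun v => by simp [clipNeg, Fin.sum_univ_four]⟩
  · refine ⟨0, ![0, -1, 0, 0], ![0, -1, 0, 0], -1, 1, -1, 1, fun v => ?_⟩
    simp [clipNeg, Fin.sum_univ_four]
    ring_nf
  · exact ⟨![0, 0, 1, 0], 0, 0, 0, 0, 0, 0, fun v => by simp [clipNeg, Fin.sum_univ_four]⟩
  · exact ⟨![0, 0, 0, 1], 0, 0, 0, 0, 0, 0, fun v => by simp [clipNeg, Fin.sum_univ_four]⟩

/-- The state after `k` bisection steps on an interval of length `L`. -/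
noncomputable def bisectState (t δ L : ℝ) (v : Fin 4 → ℝ) : ℕ → Fin 4 → ℝ
  | 0 => v
  | k + 1 => bisectUpdate (L / 2 ^ (k + 1))
      (bisectCompare t δ (L / 2 ^ (k + 1)) (bisectState t δ L v k))

theorem isDeep_bisectState (t δ L a : ℝ) (k : ℕ) : IsDeep (Fin 4 × Fin 4) (2 * k + 1)
    fun x => bisectState t δ L (foldInput a δ ![x, sin a, cos a, 0]) k := by
  induction k with
  | zero =>
    have h := (isDeep_affine (ι := Fin 4 × Fin 4) ![1, 0, 0, 0] ![0, sin a, cos a, 0]).comp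
      (isShallow_foldInput a δ)
    convert h using 2 with x
    refine congrArg (foldInput a δ) (funext fun i => ?_)
    fin_cases i <;> simp
  | succ k ih =>
    exact (ih.comp (isShallow_bisectCompare t δ _)).comp (isShallow_bisectUpdate _)

theorem bisectState_spec {t δ L a w q : ℝ} (hδ : 0 < δ) (hL : 0 ≤ L)
    (hmono : StrictMonoOn (fun y => y - t * sin y) (Set.Icc a (a + L)))
    (hq : q ∈ Set.Icc a (a + L)) (hqw : q - t * sin q = w) (c₀ : ℝ) {n : ℕ}
    (hw : ∀ j ∈ Finset.range (2 ^ n), δ ≤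
      |w - (a + j * (L / 2 ^ n) - t * sin (a + j * (L / 2 ^ n)))|) {k : ℕ} (hk : k ≤ n) :
    ∃ (j : ℕ) (y c : ℝ), j < 2 ^ k ∧ y = a + j * (L / 2 ^ k) ∧ y ≤ q ∧ q ≤ y + L / 2 ^ k ∧
      bisectState t δ L ![w - a, sin a, cos a, c₀] k = ![w - y, sin y, cos y, c] := by
  induction k with
  | zero => exact ⟨0, a, c₀, by simp, by simp, hq.1, by simpa using hq.2, rfl⟩
  | succ k ih =>
    obtain ⟨j, y, c, hj, hy, hyq, hqy, hstate⟩ := ih (by omega)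
    set h := L / 2 ^ (k + 1) with hh
    have hh2 : L / 2 ^ k = 2 * h := by rw [hh, pow_succ]; field_simp
    have hh0 : 0 ≤ h := by positivity
    rw [hh2] at hy hqy
    have hjk : (j : ℝ) + 1 ≤ 2 ^ k := by exact_mod_cast hj
    have hLh : L = 2 ^ k * (2 * h) := by rw [← hh2]; field_simp
    have hcand : y + h ∈ Set.Icc a (a + L) := by
      have hj0 : (0 : ℝ) ≤ j := j.cast_nonneg
      constructor
      · rw [hy]; nlinarith
      · rw [hy, hLh]; nlinarith
    have hgap : δ ≤ |w - (y + h - t * sin (y + h))| := by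
      obtain ⟨l, rfl⟩ := Nat.exists_eq_add_of_le hk
      have hgrid : y + h = a + ((2 * j + 1) * 2 ^ l : ℕ) * (L / 2 ^ (k + 1 + l)) := by
        rw [hy, hh]
        push_cast
        rw [pow_add _ (k + 1) l]
        field_simp
        ring
      rw [hgrid]
      refine hw _ (Finset.mem_range.2 ?_)
      rw [pow_add]
      refine Nat.mul_lt_mul_of_pos_right ?_ (by positivity)
      rw [pow_succ]; omega
    have hz : w - y - h + t * (sin y * cos h + cos y * sin h) =
        w - (y + h - t * sin (y + h)) := by rw [sin_add]; ring
    have hb1 : |sin y * cos h + cos y * sin h - sin y| ≤ 2 := by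
      rw [← sin_add]
      refine (abs_sub _ _).trans ?_
      linarith [abs_sin_le_one (y + h), abs_sin_le_one y]
    have hb2 : |cos y * cos h - sin y * sin h - cos y| ≤ 2 := by
      rw [← cos_add]
      refine (abs_sub _ _).trans ?_
      linarith [abs_cos_le_one (y + h), abs_cos_le_one y]
    rcases le_total 0 (w - (y + h - t * sin (y + h))) with hs | hs
    · rw [abs_of_nonneg hs] at hgap
      have hlt : y + h < q := (hmono.lt_iff_lt hcand hq).1 (by
        change y + h - t * sin (y + h) < q - t * sin q
        linarith)
      refine ⟨2 * j + 1, y + h, 1, by rw [pow_succ]; omega, ?_, hlt.le, by linarith, ?_⟩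
      · rw [hy]; push_cast; ring
      · have hr : ramp ((w - y - h + t * (sin y * cos h + cos y * sin h)) / δ) = 1 :=
          ramp_of_one_le (by rw [hz, le_div_iff₀ hδ]; linarith)
        rw [bisectState, hstate, ← hh]
        simp [bisectUpdate, bisectCompare, hr, gate_one, sin_add, cos_add]
        ring
    · rw [abs_of_nonpos hs] at hgap
      have hlt : q < y + h := (hmono.lt_iff_lt hq hcand).1 (by
        change q - t * sin q < y + h - t * sin (y + h)
        linarith)
      refine ⟨2 * j, y, 0, by rw [pow_succ]; omega, ?_, hyq, hlt.le, ?_⟩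
      · rw [hy]; push_cast; ring
      · have hr : ramp ((w - y - h + t * (sin y * cos h + cos y * sin h)) / δ) = 0 :=
          ramp_of_nonpos (by rw [hz]; exact div_nonpos_of_nonpos_of_nonneg hs hδ.le)
        rw [bisectState, hstate, ← hh]
        simp [bisectUpdate, bisectCompare, hr, gate_zero hb1, gate_zero hb2]

theorem abs_clipNeg_le (v : Fin 4 → ℝ) : |clipNeg v 1| ≤ 1 := by
  simp only [clipNeg, Matrix.cons_val_one, Matrix.cons_val_zero]
  rw [abs_le]
  rcases max_cases (-v 1 + 1) 0 with h | h <;> rcases max_cases (-v 1 - 1) 0 with h' | h' <;>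
    constructor <;> linarith

theorem clipNeg_of_abs_le {v : Fin 4 → ℝ} (hv : |v 1| ≤ 1) : clipNeg v 1 = -v 1 := by
  obtain ⟨h1, h2⟩ := abs_le.1 hv
  simp only [clipNeg, Matrix.cons_val_one, Matrix.cons_val_zero]
  rw [max_eq_left (by linarith), max_eq_right (by linarith)]
  ring

theorem strictMonoOn_sub_mul_sin {t a : ℝ} (ht : 1 < t) (ha : a ∈ Set.Ioo 0 π)
    (hat : a = t * sin a) :
    StrictMonoOn (fun y => y - t * sin y) (Set.Icc a (2 * π - a)) := by
  have hsin : 0 < sin a := sin_pos_of_mem_Ioo ha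
  have hcos : t * cos a < 1 := by
    rcases lt_or_ge a (π / 2) with h | h
    · have hc : 0 < cos a := cos_pos_of_mem_Ioo ⟨by linarith [ha.1], h⟩
      have htan := lt_tan ha.1 h
      rw [tan_eq_sin_div_cos, lt_div_iff₀ hc] at htan
      have : t * cos a * sin a < 1 * sin a := by
        calc t * cos a * sin a = (t * sin a) * cos a := by ring
          _ < 1 * sin a := by rw [← hat]; linarith
      exact lt_of_mul_lt_mul_right this hsin.le
    · have : cos a ≤ 0 := cos_nonpos_of_pi_div_two_le_of_le h (by linarith [ha.2, pi_pos])
      nlinarith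
  refine strictMonoOn_of_deriv_pos (convex_Icc _ _) (by fun_prop) fun y hy => ?_
  rw [interior_Icc] at hy
  have hd : HasDerivAt (fun y => y - t * sin y) (1 - t * cos y) y :=
    (hasDerivAt_id y).sub ((hasDerivAt_sin y).const_mul t)
  rw [hd.deriv]
  have hle : cos y ≤ cos a := by
    rcases le_total y π with h | h
    · exact cos_le_cos_of_nonneg_of_le_pi ha.1.le h hy.1.le
    · rw [← cos_two_pi_sub y]
      exact cos_le_cos_of_nonneg_of_le_pi ha.1.le (by linarith) (by linarith [hy.2])
  nlinarith

/-- Bound for the `L¹` seminorm over `S` of a function which is at most `2` in absolute value,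
and at most `η` off the set `N`. -/
theorem setLIntegral_abs_le_of_small_off {g : ℝ → ℝ} {S N : Set ℝ} {η : ℝ}
    (hN : MeasurableSet N) (hg : ∀ x ∈ S, |g x| ≤ 2) (hgN : ∀ x ∈ S, x ∉ N → |g x| ≤ η)
    (hS : MeasurableSet S) :
    ∫⁻ x in S, ENNReal.ofReal |g x| ≤ ENNReal.ofReal η * volume S + 2 * volume N := by
  calc ∫⁻ x in S, ENNReal.ofReal |g x|
      ≤ ∫⁻ x in S, (ENNReal.ofReal η + N.indicator (fun _ => 2) x) := by
        refine setLIntegral_mono' hS fun x hx => ?_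
        by_cases hxN : x ∈ N
        · rw [Set.indicator_of_mem hxN]
          refine le_add_left ?_
          rw [← ENNReal.ofReal_ofNat]
          exact ENNReal.ofReal_le_ofReal (hg x hx)
        · exact le_add_right (ENNReal.ofReal_le_ofReal (hgN x hx hxN))
    _ ≤ ENNReal.ofReal η * volume S + 2 * volume N := by
        rw [lintegral_add_left measurable_const, setLIntegral_const,
          lintegral_indicator hN, setLIntegral_const]
        gcongr
        exact Measure.restrict_le_self

theorem volume_iUnion_ball_le (m : ℕ) (p : ℕ → ℝ) (δ : ℝ) :
    volume (⋃ j ∈ Finset.range m, Metric.ball (p j) δ) ≤ ENNReal.ofReal (m * (2 * δ)) := by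
  refine (measure_biUnion_finset_le _ _).trans ?_
  rw [ENNReal.ofReal_mul (by positivity), ENNReal.ofReal_natCast]
  simp only [Real.volume_ball, Finset.sum_const, Finset.card_range, nsmul_eq_mul, le_refl]

theorem abs_clipNeg_bisectState_add_sin_le {t δ L a w q : ℝ} (hδ : 0 < δ) (hL : 0 ≤ L)
    (hmono : StrictMonoOn (fun y => y - t * sin y) (Set.Icc a (a + L)))
    (hq : q ∈ Set.Icc a (a + L)) (hqw : q - t * sin q = w) (c₀ : ℝ) {n : ℕ}
    (hw : ∀ j ∈ Finset.range (2 ^ n), δ ≤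
      |w - (a + j * (L / 2 ^ n) - t * sin (a + j * (L / 2 ^ n)))|) :
    |clipNeg (bisectState t δ L ![w - a, sin a, cos a, c₀] n) 1 - -sin q| ≤ L / 2 ^ n := by
  obtain ⟨_, y, c, -, -, hyq, hqy, hstate⟩ := bisectState_spec hδ hL hmono hq hqw c₀ hw le_rfl
  rw [hstate, clipNeg_of_abs_le (by simpa using abs_sin_le_one y)]
  have hlip : |sin q - sin y| ≤ |q - y| := by
    simpa [dist_eq_norm] using lipschitzWith_sin.dist_le_mul q y
  rw [abs_of_nonneg (sub_nonneg.2 hyq)] at hlip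
  calc |-(![w - y, sin y, cos y, c] : Fin 4 → ℝ) 1 - -sin q| = |sin q - sin y| := by
        congr 1; simp; ring
    _ ≤ L / 2 ^ n := by linarith

theorem foldInput_of_nonneg {a δ x : ℝ} (hδ : 0 < δ) (hx : 0 ≤ x) (s c b : ℝ) :
    foldInput a δ ![x, s, c, b] = ![x - a, s, c, b] := by
  have hr : ramp (-x / δ) = 0 :=
    ramp_of_nonpos (div_nonpos_of_nonpos_of_nonneg (by linarith) hδ.le)
  simp [foldInput, hr]

theorem foldInput_of_le_neg {a δ x : ℝ} (hδ : 0 < δ) (hx : x ≤ -δ) (s c b : ℝ) :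
    foldInput a δ ![x, s, c, b] = ![x + 2 * π - a, s, c, b] := by
  have hr : ramp (-x / δ) = 1 := ramp_of_one_le (by rw [le_div_iff₀ hδ]; linarith)
  simp [foldInput, hr]

/-- The bisection network approximates the two-period profile in `L¹`, up to the error of the
last bisection step and the volume of the exceptional set. -/
theorem exists_reLUNet_lintegral_le {t a : ℝ} (ht : 1 < t) (ha : a ∈ Set.Ioo 0 π)
    (hat : a = t * sin a) {Ψinv : ℝ → ℝ}
    (hΨinv : ∀ x ∈ Set.Icc (0 : ℝ) (2 * π),
      Ψinv x ∈ Set.Icc a (2 * π - a) ∧ Ψinv x - t * sin (Ψinv x) = x)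
    (n : ℕ) {δ : ℝ} (hδ : 0 < δ) :
    ∃ Φ : ReLUNet 1 1, Φ.depth = 2 * n + 2 ∧ Φ.width ≤ 16 ∧
      (∫⁻ x in Set.Icc (-(2 * π)) (2 * π), ENNReal.ofReal
        |Φ.eval1 x - (if x < 0 then -sin (Ψinv (x + 2 * π)) else -sin (Ψinv x))|) ≤
      ENNReal.ofReal (2 * π / 2 ^ n * (4 * π) + 2 * (δ + 2 * (2 ^ n * (2 * δ)))) := by
  set L := 2 * π - a - a with hL
  have hL0 : 0 ≤ L := by linarith [ha.2]
  have hmono := strictMonoOn_sub_mul_sin ht ha hat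
  rw [show 2 * π - a = a + L by rw [hL]; ring] at hmono hΨinv
  obtain ⟨Φ, hdepth, hwidth, heval⟩ :=
    ((isDeep_bisectState t δ L a n).comp isShallow_clipNeg).exists_reLUNet 1
  refine ⟨Φ, hdepth, by simpa using hwidth, ?_⟩
  set p : ℕ → ℝ := fun j => a + j * (L / 2 ^ n) - t * sin (a + j * (L / 2 ^ n))
  set N : Set ℝ := Set.Ioo (-δ) 0 ∪ ((⋃ j ∈ Finset.range (2 ^ n), Metric.ball (p j) δ) ∪
    ⋃ j ∈ Finset.range (2 ^ n), Metric.ball (p j - 2 * π) δ) with hN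
  have hNmeas : MeasurableSet N := by
    refine measurableSet_Ioo.union (.union ?_ ?_) <;>
      exact Finset.measurableSet_biUnion _ fun _ _ => measurableSet_ball
  have hNvol : volume N ≤ ENNReal.ofReal (δ + 2 * (2 ^ n * (2 * δ))) := by
    refine (measure_union_le _ _).trans ?_
    rw [ENNReal.ofReal_add hδ.le (by positivity)]
    refine add_le_add (by simp) ((measure_union_le _ _).trans ?_)
    rw [two_mul (_ * _), ENNReal.ofReal_add (by positivity) (by positivity)]
    exact add_le_add (by simpa using volume_iUnion_ball_le (2 ^ n) p δ)
      (by simpa using volume_iUnion_ball_le (2 ^ n) (fun j => p j - 2 * π) δ)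
  have hLle : L / 2 ^ n ≤ 2 * π / 2 ^ n := by
    gcongr
    linarith [ha.1]
  refine (setLIntegral_abs_le_of_small_off (η := 2 * π / 2 ^ n) hNmeas (fun x _ => ?_)
    (fun x hx hxN => ?_) measurableSet_Icc).trans ?_
  · rw [heval]
    refine (abs_sub _ _).trans ?_
    have h1 := abs_clipNeg_le (bisectState t δ L (foldInput a δ ![x, sin a, cos a, 0]) n)
    split_ifs
    · linarith [abs_sin_le_one (Ψinv (x + 2 * π)), abs_neg (sin (Ψinv (x + 2 * π)))]
    · linarith [abs_sin_le_one (Ψinv x), abs_neg (sin (Ψinv x))]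
  · simp only [hN, Set.mem_union, Set.mem_Ioo, Set.mem_iUnion, Metric.mem_ball, Real.dist_eq,
      not_or, not_and, not_exists, not_lt, exists_prop] at hxN
    obtain ⟨hx0, hxp, hxp'⟩ := hxN
    rw [heval]
    refine le_trans ?_ hLle
    split_ifs with hneg
    · have hxδ : x ≤ -δ := by
        by_contra! h
        exact absurd (hx0 h) (not_le.2 hneg)
      obtain ⟨hq, hqw⟩ := hΨinv (x + 2 * π) ⟨by linarith [hx.1], by linarith⟩
      rw [foldInput_of_le_neg hδ hxδ]
      refine abs_clipNeg_bisectState_add_sin_le hδ hL0 hmono hq hqw 0 fun j hj => ?_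
      have hxj := hxp' j hj
      rwa [show x - (p j - 2 * π) = x + 2 * π - p j by ring] at hxj
    · have hx0 : 0 ≤ x := not_lt.1 hneg
      obtain ⟨hq, hqw⟩ := hΨinv x ⟨hx0, hx.2⟩
      rw [foldInput_of_nonneg hδ hx0]
      exact abs_clipNeg_bisectState_add_sin_le hδ hL0 hmono hq hqw 0 fun j hj => hxp j hj
  · rw [Real.volume_Icc, ENNReal.ofReal_add (by positivity) (by positivity),
      ENNReal.ofReal_mul (by positivity), ENNReal.ofReal_mul (p := 2) (by norm_num),
      ENNReal.ofReal_ofNat]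
    have : 2 * π - -(2 * π) = 4 * π := by ring
    rw [this]
    gcongr

end Bisection

/-- **Lemma (L¹ ReLU approximation of the shifted Burgers profile).** Let $t > 1$, with
$x_t ∈ (0,π)$ solving $x_t = t \sin x_t$ and $Ψ_t^{-1}$ the inverse of
$Ψ_t(x_0) = x_0 - t \sin x_0$ on $[0,2π]$. Define $U : [-2π,2π] → ℝ$ by
$U(x) = -\sin(Ψ_t^{-1}(x+2π))$ for $x < 0$ and $U(x) = -\sin(Ψ_t^{-1}(x))$ for $x ≥ 0$.
Then there is $C = C(t) > 0$ such that for every $ε ∈ (0,1/2]$ there is a ReLU network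
$Φ_ε : ℝ → ℝ$ of depth $≤ C \log(ε^{-1})^2$ and width $≤ C$ with
$‖Φ_ε - U‖_{L¹([-2π,2π])} ≤ ε$. -/
theorem relu_L1_approx_burgers_profile (t : ℝ) (ht : 1 < t)
    (xt : ℝ) (hxt : xt ∈ Set.Ioo 0 π) (hxteq : xt = t * sin xt)
    (Ψinv : ℝ → ℝ)
    (hΨinv : ∀ x ∈ Set.Icc (0 : ℝ) (2 * π),
      Ψinv x ∈ Set.Icc xt (2 * π - xt) ∧ Ψinv x - t * sin (Ψinv x) = x) :
    ∃ C > (0 : ℝ), ∀ ε : ℝ, 0 < ε → ε ≤ 1 / 2 →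
      ∃ Φ : ReLUNet 1 1,
        (Φ.depth : ℝ) ≤ C * Real.log ε⁻¹ ^ 2 ∧
        (Φ.width : ℝ) ≤ C ∧
        (∫⁻ x in Set.Icc (-(2 * π)) (2 * π),
            ENNReal.ofReal
              |Φ.eval1 x -
                (if x < 0 then -sin (Ψinv (x + 2 * π)) else -sin (Ψinv x))|) ≤
          ENNReal.ofReal ε := by
  have hlog2 := log_two_gt_d9
  refine ⟨100, by norm_num, fun ε hε hε2 => ?_⟩
  set l := log ε⁻¹ with hl
  have hl2 : log 2 ≤ l :=
    log_le_log (by norm_num) ((le_inv_comm₀ (by norm_num) hε).2 (by linarith))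
  set n := ⌈2 * l⌉₊ + 8 with hn
  have hnle : (n : ℝ) ≤ 2 * l + 9 := by
    rw [hn]
    push_cast
    linarith [(Nat.ceil_lt_add_one (by linarith : 0 ≤ 2 * l)).le]
  have hpow : 256 ≤ ε * 2 ^ n := by
    have h1 : ε⁻¹ ≤ 2 ^ ⌈2 * l⌉₊ := by
      rw [← log_le_log_iff (by positivity) (by positivity), log_pow, ← hl]
      nlinarith [Nat.le_ceil (2 * l)]
    rw [hn, pow_add]
    rw [inv_le_iff_one_le_mul₀ hε] at h1
    nlinarith
  obtain ⟨Φ, hdepth, hwidth, hΦ⟩ :=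
    exists_reLUNet_lintegral_le ht hxt hxteq hΨinv n (δ := 1 / 4 ^ n) (by positivity)
  refine ⟨Φ, ?_, ?_, hΦ.trans (ENNReal.ofReal_le_ofReal ?_)⟩
  · rw [hdepth]
    push_cast
    nlinarith
  · exact (Nat.cast_le.2 hwidth).trans (by norm_num)
  · have h4 : (4 : ℝ) ^ n = 2 ^ n * 2 ^ n := by rw [← mul_pow]; norm_num
    have h1 : (1 : ℝ) ≤ 2 ^ n := one_le_pow₀ (by norm_num)
    have hb : (1 : ℝ) / 4 ^ n ≤ 1 / 2 ^ n := by
      rw [h4]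
      exact one_div_le_one_div_of_le (by positivity) (by nlinarith)
    have hc : (2 : ℝ) ^ n * (2 * (1 / 4 ^ n)) = 2 * (1 / 2 ^ n) := by rw [h4]; field_simp
    have hε' : 256 * (1 / 2 ^ n) ≤ ε := by
      rw [mul_one_div, div_le_iff₀ (by positivity)]
      exact hpow
    have hπ : π ^ 2 ≤ 16 := by nlinarith [pi_le_four, pi_pos]
    have hd : (0 : ℝ) < 1 / 2 ^ n := by positivity
    calc 2 * π / 2 ^ n * (4 * π) + 2 * (1 / 4 ^ n + 2 * (2 ^ n * (2 * (1 / 4 ^ n))))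
        = 8 * π ^ 2 * (1 / 2 ^ n) + 2 * (1 / 4 ^ n + 4 * (1 / 2 ^ n)) := by rw [hc]; ring
      _ ≤ 256 * (1 / 2 ^ n) := by nlinarith
      _ ≤ ε := hε'
end
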